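/- arXiv:1703.10840 — 2 statements merged into one kernel-verified Lean document; each statement's English description precedes it below -/
import Mathlib

section
/- Let N be an unrooted binary phylogenetic network and T an unrooted binary phylogenetic tree, both on the same label set X with |X| ≥ 3. If N displays T then tw(D(N,T)) ≤ min{2·tw(N) + 1, r(N) + 2}, where r(N) = |E(N)| − (|V(N)| − 1) is the reticulation number of N. -/
open SimpleGraph

/-- `G` has a tree decomposition of width at most `k`: a tree `t` together with
bags satisfying (tw1), (tw2) and (tw3), all of whose bags have size at most `k+1`. -/
def HasTreeDecompWidthLE {V : Type*} (G : SimpleGraph V) (k : ℕ) : Prop :=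
  ∃ (n : ℕ) (t : SimpleGraph (Fin (n + 1))) (bag : Fin (n + 1) → Finset V),
    t.IsTree ∧
    (∀ v : V, ∃ i, v ∈ bag i) ∧
    (∀ u v : V, G.Adj u v → ∃ i, u ∈ bag i ∧ v ∈ bag i) ∧
    (∀ v : V, (t.induce {i | v ∈ bag i}).Connected) ∧
    (∀ i, (bag i).card ≤ k + 1)

/-- The treewidth of a graph: the least `k` such that `G` has a tree decomposition
of width `k`. -/
noncomputable def treewidth {V : Type*} (G : SimpleGraph V) : ℕ :=
  sInf {k | HasTreeDecompWidthLE G k}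

/-- An unrooted binary phylogenetic graph (tree or network) on label set `X`:
a finite connected graph whose degree-1 vertices are bijectively labelled by `X`
and all of whose other vertices have degree 3. -/
structure PhyloGraph (V : Type*) (X : Type*) where
  graph : SimpleGraph V
  finite : Finite V
  connected : graph.Connected
  leaf : X → V
  leaf_inj : Function.Injective leaf
  leaf_deg : ∀ x : X, (graph.neighborSet (leaf x)).ncard = 1
  internal_deg : ∀ v : V, (∀ x : X, leaf x ≠ v) → (graph.neighborSet v).ncard = 3

/-- An unrooted binary phylogenetic tree on label set `X`. -/
structure PhyloTree (V : Type*) (X : Type*) extends PhyloGraph V X where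
  acyclic : graph.IsAcyclic

open Classical in
/-- The map identifying a leaf of the second graph with the leaf of the first
graph carrying the same label. -/
noncomputable def mergeMap {V1 V2 X : Type*} (l1 : X → V1) (l2 : X → V2) :
    V1 ⊕ V2 → V1 ⊕ V2
  | Sum.inl v => Sum.inl v
  | Sum.inr w => if h : ∃ x, l2 x = w then Sum.inl (l1 h.choose) else Sum.inr w

lemma mergeMap_idem {V1 V2 X : Type*} (l1 : X → V1) (l2 : X → V2) (u : V1 ⊕ V2) :
    mergeMap l1 l2 (mergeMap l1 l2 u) = mergeMap l1 l2 u := by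
  classical
  cases u with
  | inl v => rfl
  | inr w =>
    by_cases h : ∃ x, l2 x = w
    · simp [mergeMap, h]
    · simp [mergeMap, h]

/-- The vertex set of the display graph: the disjoint union of the vertex sets
of the two graphs, with leaves carrying the same label identified. -/
def DisplayVertex {V1 V2 X : Type*} (l1 : X → V1) (l2 : X → V2) : Type _ :=
  {u : V1 ⊕ V2 // mergeMap l1 l2 u = u}

/-- The canonical map from `V1 ⊕ V2` to the vertex set of the display graph. -/
noncomputable def toDisplay {V1 V2 X : Type*} (l1 : X → V1) (l2 : X → V2) (u : V1 ⊕ V2) :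
    DisplayVertex l1 l2 :=
  ⟨mergeMap l1 l2 u, mergeMap_idem l1 l2 u⟩

/-- The display graph of two leaf-labelled graphs: their disjoint union with the
leaves carrying the same label identified. -/
noncomputable def displayGraph {V1 V2 X : Type*} (G1 : SimpleGraph V1) (l1 : X → V1)
    (G2 : SimpleGraph V2) (l2 : X → V2) : SimpleGraph (DisplayVertex l1 l2) :=
  SimpleGraph.fromRel (fun a b =>
    (∃ u v : V1, G1.Adj u v ∧ a = toDisplay l1 l2 (Sum.inl u) ∧ b = toDisplay l1 l2 (Sum.inl v)) ∨
    (∃ u v : V2, G2.Adj u v ∧ a = toDisplay l1 l2 (Sum.inr u) ∧ b = toDisplay l1 l2 (Sum.inr v)))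

/-- The treewidth distance between two phylogenetic trees:
`d_tw(T1,T2) = tw(D(T1,T2)) - 2`. -/
noncomputable def dtw {V1 V2 X : Type*} (T1 : PhyloTree V1 X) (T2 : PhyloTree V2 X) : ℕ :=
  treewidth (displayGraph T1.graph T1.leaf T2.graph T2.leaf) - 2

/-- Two phylogenetic trees are compatible if there is a label-preserving
isomorphism between them. -/
def Compatible {V1 V2 X : Type*} (T1 : PhyloTree V1 X) (T2 : PhyloTree V2 X) : Prop :=
  ∃ φ : T1.graph ≃g T2.graph, ∀ x : X, φ (T1.leaf x) = T2.leaf x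

/-- The graph obtained from `H` by suppressing all its degree-2 vertices: its
vertices are the vertices of `H` of degree other than 2, two of them being
adjacent iff they are joined in `H` by a path all of whose internal vertices
have degree 2. -/
def Smoothing {W : Type*} (H : SimpleGraph W) :
    SimpleGraph {w : W // (H.neighborSet w).ncard ≠ 2} :=
  SimpleGraph.fromRel (fun a b =>
    ∃ p : H.Walk a.1 b.1, p.IsPath ∧
      ∀ x ∈ p.support, x = a.1 ∨ x = b.1 ∨ (H.neighborSet x).ncard = 2)

/-- The network `N` displays the tree `T`: `N` has a subgraph which is a
subdivision of `T` (i.e. a connected subgraph which, after suppressing its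
degree-2 vertices, is label-preservingly isomorphic to `T`). -/
def Displays {V W X : Type*} (N : PhyloGraph V X) (T : PhyloTree W X) : Prop :=
  ∃ S : N.graph.Subgraph, S.coe.Connected ∧
    ∃ e : Smoothing S.coe ≃g T.graph,
      ∀ x : X, ((e.symm (T.leaf x)).1 : S.verts).1 = N.leaf x

/-- The reticulation number `r(N) = |E| - (|V| - 1)` of a network `N`. -/
noncomputable def reticNumber {V X : Type*} (N : PhyloGraph V X) : ℕ :=
  N.graph.edgeSet.ncard - (Nat.card V - 1)

/-- Reachability inside a vertex set. -/
def RI {V : Type*} (G : SimpleGraph V) (s : Set V) (u v : V) : Prop :=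
  ∃ q : G.Walk u v, ∀ x ∈ q.support, x ∈ s

namespace RI

variable {V : Type*} {G : SimpleGraph V} {s s' : Set V} {u v w : V}

lemma refl (h : u ∈ s) : RI G s u u := ⟨Walk.nil, by simpa using h⟩

lemma symm (h : RI G s u v) : RI G s v u := by
  obtain ⟨q, hq⟩ := h
  exact ⟨q.reverse, by simpa using hq⟩

lemma trans (h : RI G s u v) (h' : RI G s v w) : RI G s u w := by
  obtain ⟨q, hq⟩ := h
  obtain ⟨q', hq'⟩ := h'
  refine ⟨q.append q', fun x hx => ?_⟩
  rw [Walk.mem_support_append_iff] at hx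
  exact hx.elim (hq x) (hq' x)

lemma adj (h : G.Adj u v) (hu : u ∈ s) (hv : v ∈ s) : RI G s u v :=
  ⟨h.toWalk, by simp [hu, hv]⟩

lemma mono (h : RI G s u v) (hs : s ⊆ s') : RI G s' u v := by
  obtain ⟨q, hq⟩ := h
  exact ⟨q, fun x hx => hs (hq x hx)⟩

lemma map {V' : Type*} {G' : SimpleGraph V'} (φ : G →g G') {s' : Set V'}
    (h : RI G s u v) (hs : ∀ x ∈ s, φ x ∈ s') : RI G' s' (φ u) (φ v) := by
  obtain ⟨q, hq⟩ := h
  refine ⟨q.map φ, fun x hx => ?_⟩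
  rw [Walk.support_map, List.mem_map] at hx
  obtain ⟨y, hy, rfl⟩ := hx
  exact hs y (hq y hy)

lemma of_induce (h : (G.induce s).Preconnected) (hu : u ∈ s) (hv : v ∈ s) : RI G s u v := by
  obtain ⟨q⟩ := h ⟨u, hu⟩ ⟨v, hv⟩
  have h' : RI (G.induce s) Set.univ ⟨u, hu⟩ ⟨v, hv⟩ := ⟨q, fun _ _ => trivial⟩
  exact h'.map (⟨Subtype.val, fun h => h⟩ : G.induce s →g G) (fun x _ => x.2)

lemma induce_connected (hne : s.Nonempty) (h : ∀ u ∈ s, ∀ v ∈ s, RI G s u v) :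
    (G.induce s).Connected := by
  have : Nonempty s := hne.to_subtype
  refine ⟨?_⟩
  rintro ⟨u, hu⟩ ⟨v, hv⟩
  obtain ⟨q, hq⟩ := h u hu v hv
  exact ⟨q.induce s hq⟩

end RI

/-- Tree decompositions indexed by arbitrary finite types. -/
lemma hasTD_of_type {V I : Type*} [Finite I] (G : SimpleGraph V) (k : ℕ)
    (t : SimpleGraph I) (bag : I → Finset V) (ht : t.IsTree)
    (h1 : ∀ v : V, ∃ i, v ∈ bag i)
    (h2 : ∀ u v : V, G.Adj u v → ∃ i, u ∈ bag i ∧ v ∈ bag i)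
    (h3 : ∀ v i j, v ∈ bag i → v ∈ bag j → RI t {i | v ∈ bag i} i j)
    (h4 : ∀ i, (bag i).card ≤ k + 1) : HasTreeDecompWidthLE G k := by
  classical
  have := Fintype.ofFinite I
  have : Nonempty I := ht.connected.nonempty
  obtain ⟨n, hn⟩ : ∃ n, Fintype.card I = n + 1 :=
    ⟨Fintype.card I - 1, by have := Fintype.card_pos (α := I); omega⟩
  let e : I ≃ Fin (n + 1) := Fintype.equivFinOfCardEq hn
  let φ : t ≃g t.map e.toEmbedding := Iso.map e t
  refine ⟨n, t.map e.toEmbedding, fun i => bag (e.symm i), φ.isTree_iff.1 ht, ?_, ?_, ?_, ?_⟩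
  · intro v
    obtain ⟨i, hi⟩ := h1 v
    exact ⟨e i, by simpa using hi⟩
  · intro u v h
    obtain ⟨i, hi⟩ := h2 u v h
    exact ⟨e i, by simpa using hi⟩
  · intro v
    refine RI.induce_connected ?_ ?_
    · obtain ⟨i, hi⟩ := h1 v
      exact ⟨e i, by simpa using hi⟩
    · intro i hi j hj
      have := (h3 v (e.symm i) (e.symm j) hi hj).map (s' := {i | v ∈ bag (e.symm i)}) φ.toHom
        (by
          intro x hx
          simpa [φ] using hx)
      simpa [φ] using this
  · intro i
    exact h4 _

lemma toDisplay_eq {V W X : Type*} {l1 : X → V} {l2 : X → W}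
    (h1 : Function.Injective l1) {a b : V ⊕ W} (h : toDisplay l1 l2 a = toDisplay l1 l2 b) :
    a = b ∨ (∃ x, a = Sum.inl (l1 x) ∧ b = Sum.inr (l2 x)) ∨
      (∃ x, b = Sum.inl (l1 x) ∧ a = Sum.inr (l2 x)) := by
  classical
  have h' : mergeMap l1 l2 a = mergeMap l1 l2 b := congrArg Subtype.val h
  rcases a with v | w <;> rcases b with v' | w'
  · left; simpa [mergeMap] using h'
  · by_cases hx : ∃ x, l2 x = w'
    · simp only [mergeMap, hx, dite_true] at h'
      right; left
      exact ⟨hx.choose, h', by rw [hx.choose_spec]⟩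
    · simp [mergeMap, hx] at h'
  · by_cases hx : ∃ x, l2 x = w
    · simp only [mergeMap, hx, dite_true] at h'
      right; right
      exact ⟨hx.choose, h'.symm, by rw [hx.choose_spec]⟩
    · simp [mergeMap, hx] at h'
  · by_cases hx : ∃ x, l2 x = w <;> by_cases hx' : ∃ x, l2 x = w'
    · simp only [mergeMap, hx, hx', dite_true] at h'
      have := h1 (Sum.inl.inj h')
      left
      rw [← hx.choose_spec, ← hx'.choose_spec, this]
    · simp [mergeMap, hx, hx'] at h'
    · simp [mergeMap, hx, hx'] at h'
    · left
      simpa [mergeMap, hx, hx'] using h'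

/-- Tree decompositions of a display graph from bags in the disjoint union. -/
lemma hasTD_display {V W X I : Type*} [Finite I] (G1 : SimpleGraph V) (l1 : X → V)
    (G2 : SimpleGraph W) (l2 : X → W) (hinj : Function.Injective l1) (k : ℕ)
    (t : SimpleGraph I) (bag : I → Finset (V ⊕ W)) (ht : t.IsTree)
    (h1 : ∀ v, ∃ i, v ∈ bag i)
    (hl : ∀ x, ∃ i, Sum.inl (l1 x) ∈ bag i ∧ Sum.inr (l2 x) ∈ bag i)
    (h2 : ∀ u v : V, G1.Adj u v → ∃ i, Sum.inl u ∈ bag i ∧ Sum.inl v ∈ bag i)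
    (h2' : ∀ u v : W, G2.Adj u v → ∃ i, Sum.inr u ∈ bag i ∧ Sum.inr v ∈ bag i)
    (h3 : ∀ v i j, v ∈ bag i → v ∈ bag j → RI t {i | v ∈ bag i} i j)
    (h4 : ∀ i, (bag i).card ≤ k + 1) :
    HasTreeDecompWidthLE (displayGraph G1 l1 G2 l2) k := by
  classical
  have hmem : ∀ {a i}, a ∈ bag i → toDisplay l1 l2 a ∈ (bag i).image (toDisplay l1 l2) :=
    fun h => Finset.mem_image_of_mem _ h
  refine hasTD_of_type _ k t (fun i => (bag i).image (toDisplay l1 l2)) ht ?_ ?_ ?_ ?_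
  · rintro ⟨u, hu⟩
    obtain ⟨i, hi⟩ := h1 u
    refine ⟨i, ?_⟩
    have : (⟨u, hu⟩ : DisplayVertex l1 l2) = toDisplay l1 l2 u := Subtype.ext hu.symm
    rw [this]
    exact hmem hi
  · have key : ∀ a b : DisplayVertex l1 l2,
      ((∃ u v : V, G1.Adj u v ∧ a = toDisplay l1 l2 (Sum.inl u) ∧ b = toDisplay l1 l2 (Sum.inl v)) ∨
      (∃ u v : W, G2.Adj u v ∧ a = toDisplay l1 l2 (Sum.inr u) ∧ b = toDisplay l1 l2 (Sum.inr v)))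
      → ∃ i, a ∈ (bag i).image (toDisplay l1 l2) ∧ b ∈ (bag i).image (toDisplay l1 l2) := by
      rintro a b (⟨u, v, h, rfl, rfl⟩ | ⟨u, v, h, rfl, rfl⟩)
      · obtain ⟨i, hi, hi'⟩ := h2 u v h
        exact ⟨i, hmem hi, hmem hi'⟩
      · obtain ⟨i, hi, hi'⟩ := h2' u v h
        exact ⟨i, hmem hi, hmem hi'⟩
    intro a b hab
    rw [displayGraph, fromRel_adj] at hab
    rcases hab.2 with h | h
    · exact key a b h
    · obtain ⟨i, hi, hi'⟩ := key b a h
      exact ⟨i, hi', hi⟩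
  · intro d i j hi hj
    obtain ⟨a, ha, rfl⟩ := Finset.mem_image.1 hi
    obtain ⟨b, hb, hab⟩ := Finset.mem_image.1 hj
    have hA : ∀ i j, a ∈ bag i → a ∈ bag j →
        RI t {i | toDisplay l1 l2 a ∈ (bag i).image (toDisplay l1 l2)} i j := fun i j h h' =>
      (h3 a i j h h').mono (fun _ h => hmem h)
    have hB : ∀ i j, b ∈ bag i → b ∈ bag j →
        RI t {i | toDisplay l1 l2 a ∈ (bag i).image (toDisplay l1 l2)} i j := fun i j h h' =>
      (h3 b i j h h').mono (fun _ h => by rw [← hab]; exact hmem h)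
    rcases toDisplay_eq hinj hab with rfl | ⟨x, rfl, rfl⟩ | ⟨x, rfl, rfl⟩
    · exact hA _ _ ha hb
    · obtain ⟨m, hm, hm'⟩ := hl x
      exact (hA _ m ha hm').trans (hB _ _ hm hb)
    · obtain ⟨m, hm, hm'⟩ := hl x
      exact (hA _ m ha hm).trans (hB _ _ hm' hb)
  · intro i
    exact Finset.card_image_le.trans (h4 i)

/-- The graph of a parent function. -/
def parGraph {I : Type*} (p : I → I) : SimpleGraph I :=
  SimpleGraph.fromRel (fun i j => j = p i)

lemma parGraph_adj {I : Type*} {p : I → I} {i : I} (h : p i ≠ i) : (parGraph p).Adj i (p i) := by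
  rw [parGraph, fromRel_adj]
  exact ⟨h.symm, Or.inl rfl⟩

lemma parGraph_isTree {I : Type*} [Finite I] (p : I → I) (r : I) (rank : I → ℕ)
    (hr : p r = r) (hp : ∀ i, i ≠ r → rank (p i) < rank i) : (parGraph p).IsTree := by
  classical
  have hreach : ∀ n i, rank i = n → (parGraph p).Reachable i r := by
    intro n
    induction n using Nat.strong_induction_on with
    | _ n ih =>
      intro i hi
      by_cases h : i = r
      · rw [h]
      · have := hp i h
        have h' := ih _ (hi ▸ this) _ rfl
        refine Reachable.trans (Adj.reachable (parGraph_adj ?_)) h'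
        intro h0
        rw [h0] at this
        exact lt_irrefl _ this
  have hconn : (parGraph p).Connected := by
    have : Nonempty I := ⟨r⟩
    exact ⟨fun i j => (hreach _ i rfl).trans (hreach _ j rfl).symm⟩
  rw [isTree_iff_connected_and_card]
  refine ⟨hconn, le_antisymm ?_ hconn.card_vert_le_card_edgeSet_add_one⟩
  have := Fintype.ofFinite I
  have hsub : (parGraph p).edgeSet ⊆ (fun i => s(i, p i)) '' {i | i ≠ r} := by
    intro e
    induction e using Sym2.ind with
    | _ i j =>
      intro h
      rw [mem_edgeSet, parGraph, fromRel_adj] at h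
      obtain ⟨hne, h | h⟩ := h
      · exact ⟨i, fun h0 => hne (by rw [h, h0, hr]), by simp [h]⟩
      · exact ⟨j, fun h0 => hne (by rw [h, h0, hr]), by simp [h, Sym2.eq_swap]⟩
  have h1 : (parGraph p).edgeSet.ncard ≤ ({i | i ≠ r} : Set I).ncard :=
    (Set.ncard_le_ncard hsub (Set.toFinite _)).trans (Set.ncard_image_le (Set.toFinite _))
  have h2 : ({i | i ≠ r} : Set I).ncard + 1 = Nat.card I := by
    have := Set.ncard_add_ncard_compl ({r} : Set I)
    rw [Set.ncard_singleton] at this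
    have h3 : ({r}ᶜ : Set I) = {i | i ≠ r} := by ext; simp
    rw [h3] at this
    omega
  have h4 : Nat.card (parGraph p).edgeSet = (parGraph p).edgeSet.ncard := rfl
  omega

/-- A neighbour of an internal degree-2 vertex of a path lies on the path. -/
lemma path_internal {U : Type*} [Finite U] {H : SimpleGraph U} {a b x y : U} {q : H.Walk a b}
    (hq : q.IsPath) (hx : x ∈ q.support) (hxa : x ≠ a) (hxb : x ≠ b)
    (hdeg : (H.neighborSet x).ncard = 2) (hxy : H.Adj x y) : y ∈ q.support := by
  obtain ⟨i, rfl, hi⟩ := Walk.mem_support_iff_exists_getVert.1 hx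
  have hi0 : i ≠ 0 := by
    rintro rfl
    simp at hxa
  have hil : i < q.length := by
    rcases hi.lt_or_eq with h | h
    · exact h
    · rw [h] at hxb
      simp at hxb
  have h2 := hq.ncard_neighborSet_toSubgraph_internal_eq_two hi0 hil
  have heq : q.toSubgraph.neighborSet (q.getVert i) = H.neighborSet (q.getVert i) :=
    Set.eq_of_subset_of_ncard_le (Subgraph.neighborSet_subset _ _) (by rw [h2, hdeg])
      (Set.toFinite _)
  have hy : y ∈ q.toSubgraph.neighborSet (q.getVert i) := by
    rw [heq]
    exact hxy
  have := q.toSubgraph.edge_vert (Subgraph.Adj.symm hy)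
  simpa using this

/-- Walking along degree-2 vertices from a vertex of such a path one stays on the path. -/
lemma walk_stays {U : Type*} [Finite U] {H : SimpleGraph U} {a b : U} {q : H.Walk a b}
    (hq : q.IsPath) (ha : (H.neighborSet a).ncard ≠ 2) (hb : (H.neighborSet b).ncard ≠ 2)
    {x y : U} (q' : H.Walk x y) (hx : x ∈ q.support)
    (hq' : ∀ z ∈ q'.support, z = y ∨ (H.neighborSet z).ncard = 2) : y ∈ q.support := by
  induction q' with
  | nil => exact hx
  | @cons x z y h q' ih =>
    rcases hq' x (by simp) with rfl | hdeg
    · exact hx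
    · refine ih (path_internal hq hx ?_ ?_ hdeg h) (fun z hz => hq' z (by simp [hz]))
      · rintro rfl
        exact ha hdeg
      · rintro rfl
        exact hb hdeg

lemma branch_sets {U W : Type*} [Finite U] (H : SimpleGraph U) (K : SimpleGraph W)
    (e : Smoothing H ≃g K) (w0 : W) (pT : W → W) (ρ : W → ℕ)
    (hp : ∀ w, w ≠ w0 → K.Adj w (pT w) ∧ ρ (pT w) < ρ w) :
    ∃ B : W → Set U, (∀ w, (e.symm w).1 ∈ B w) ∧
      (∀ w w' x, x ∈ B w → x ∈ B w' → w = w') ∧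
      (∀ w x, x ∈ B w → RI H (B w) x (e.symm w).1) ∧
      (∀ w, w ≠ w0 → ∃ c ∈ B w, H.Adj c (e.symm (pT w)).1) := by
  classical
  have hP : ∀ w, w ≠ w0 → ∃ q : H.Walk (e.symm w).1 (e.symm (pT w)).1, q.IsPath ∧
      ∀ x ∈ q.support, x = (e.symm w).1 ∨ x = (e.symm (pT w)).1 ∨
        (H.neighborSet x).ncard = 2 := by
    intro w hw
    have h0 : (Smoothing H).Adj (e.symm w) (e.symm (pT w)) := (e.symm.map_adj_iff).2 (hp w hw).1
    have h := (fromRel_adj _ _ _).1 h0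
    obtain ⟨-, ⟨q, hq, hq'⟩ | ⟨q, hq, hq'⟩⟩ := h
    · exact ⟨q, hq, hq'⟩
    · refine ⟨q.reverse, hq.reverse, fun x hx => ?_⟩
      rw [Walk.support_reverse, List.mem_reverse] at hx
      rcases hq' x hx with h | h | h
      · exact Or.inr (Or.inl h)
      · exact Or.inl h
      · exact Or.inr (Or.inr h)
  choose P hPp hPs using hP
  have hφ : ∀ {w w'}, ((e.symm w).1 : U) = (e.symm w').1 → w = w' := fun h =>
    e.symm.injective (Subtype.ext h)
  have hdeg : ∀ w, (H.neighborSet (e.symm w).1).ncard ≠ 2 := fun w => (e.symm w).2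
  have hpne : ∀ w, w ≠ w0 → (e.symm w).1 ≠ (e.symm (pT w)).1 := fun w hw h =>
    (hp w hw).1.ne (hφ h)
  -- crossing
  have hcross : ∀ w (hw : w ≠ w0) w' (hw' : w' ≠ w0) x, x ∈ (P w hw).support →
      x ∈ (P w' hw').support → (H.neighborSet x).ncard = 2 → w' = w ∨ w' = pT w := by
    intro w hw w' hw' x hx hx' hd
    have hne : x ≠ (e.symm (pT w')).1 := by
      rintro rfl
      exact hdeg _ hd
    have hend := Walk.endpoint_notMem_support_takeUntil (hPp w' hw') hx' hne.symm
    have hin := walk_stays (hPp w hw) (hdeg _) (hdeg _) ((P w' hw').takeUntil x hx').reverse hx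
      (by
        intro z hz
        rw [Walk.support_reverse, List.mem_reverse] at hz
        rcases hPs w' hw' z (Walk.support_takeUntil_subset_support _ _ hz) with h | h | h
        · exact Or.inl h
        · exact absurd (h ▸ hz) hend
        · exact Or.inr h)
    rcases hPs w hw _ hin with h | h | h
    · exact Or.inl (hφ h)
    · exact Or.inr (hφ h)
    · exact absurd h (hdeg _)
  let B : W → Set U := fun w => {x | x = (e.symm w).1 ∨
    ∃ hw : w ≠ w0, x ∈ (P w hw).support ∧ x ≠ (e.symm (pT w)).1}
  have hBdeg : ∀ w x, x ∈ B w → x = (e.symm w).1 ∨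
      ((H.neighborSet x).ncard = 2 ∧ ∃ hw : w ≠ w0, x ∈ (P w hw).support) := by
    rintro w x (h | ⟨hw, hx, hx'⟩)
    · exact Or.inl h
    · rcases hPs w hw x hx with h | h | h
      · exact Or.inl h
      · exact absurd h hx'
      · exact Or.inr ⟨h, hw, hx⟩
  refine ⟨B, fun w => Or.inl rfl, ?_, ?_, ?_⟩
  · intro w w' x hx hx'
    rcases hBdeg w x hx with h | ⟨h, hw, hxs⟩ <;> rcases hBdeg w' x hx' with h' | ⟨h', hw', hxs'⟩
    · exact hφ (h.symm.trans h')
    · exact absurd h' (h ▸ hdeg w)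
    · exact absurd h (h' ▸ hdeg w')
    · rcases hcross w hw w' hw' x hxs hxs' h with h1 | h1
      · exact h1.symm
      · rcases hcross w' hw' w hw x hxs' hxs h with h2 | h2
        · exact h2
        · have h3 := (hp w hw).2
          have h4 := (hp w' hw').2
          rw [← h1] at h3
          rw [← h2] at h4
          omega
  · rintro w x (rfl | ⟨hw, hx, hx'⟩)
    · exact RI.refl (Or.inl rfl)
    · refine RI.symm ⟨(P w hw).takeUntil x hx, fun z hz => ?_⟩
      refine Or.inr ⟨hw, Walk.support_takeUntil_subset_support _ _ hz, ?_⟩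
      rintro rfl
      exact Walk.endpoint_notMem_support_takeUntil (hPp w hw) hx hx'.symm hz
  · intro w hw
    have hnil : ¬ (P w hw).Nil := Walk.not_nil_of_ne (hpne w hw)
    refine ⟨(P w hw).penultimate, Or.inr ⟨hw, List.mem_of_mem_dropLast (Walk.penultimate_mem_dropLast_support hnil), ?_⟩,
      Walk.adj_penultimate hnil⟩
    exact (Walk.adj_penultimate hnil).ne

/-- Extend disjoint connected sets in a connected graph to a partition. -/
lemma extend_sets {V W : Type*} [Finite V] [Nonempty W] (G : SimpleGraph V) (hG : G.Connected)
    (a : W → V) : ∀ (n : ℕ) (B : W → Set V), (⋃ w, B w)ᶜ.ncard = n → (∀ w, a w ∈ B w) →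
      (∀ w w' x, x ∈ B w → x ∈ B w' → w = w') →
      (∀ w x, x ∈ B w → RI G (B w) x (a w)) →
      ∃ f : V → W, (∀ w x, x ∈ B w → f x = w) ∧
        ∀ v, RI G {x | f x = f v} v (a (f v)) := by
  classical
  intro n
  induction n with
  | zero =>
    intro B hn ha hd hc
    rw [Set.ncard_eq_zero (Set.toFinite _), Set.compl_empty_iff] at hn
    have : ∀ v, ∃ w, v ∈ B w := fun v => by
      have : v ∈ ⋃ w, B w := hn ▸ Set.mem_univ v
      simpa using this
    choose f hf using this
    have hfB : ∀ w x, x ∈ B w → f x = w := fun w x hx => hd _ _ x (hf x) hx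
    exact ⟨f, hfB, fun v => (hc _ v (hf v)).mono (fun x hx => hfB _ x hx)⟩
  | succ n ih =>
    intro B hn ha hd hc
    have hne : ((⋃ w, B w)ᶜ).Nonempty := by
      rw [← Set.ncard_pos (Set.toFinite _)]
      omega
    obtain ⟨v0, hv0⟩ := hne
    obtain ⟨w1⟩ := ‹Nonempty W›
    obtain ⟨q⟩ := hG.preconnected (a w1) v0
    obtain ⟨d, -, hd1, hd2⟩ := q.exists_boundary_dart (⋃ w, B w)
      (Set.mem_iUnion.2 ⟨w1, ha w1⟩) hv0
    obtain ⟨w2, hw2⟩ := Set.mem_iUnion.1 hd1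
    have hd2' : ∀ w, d.snd ∉ B w := fun w h => hd2 (Set.mem_iUnion.2 ⟨w, h⟩)
    let B' : W → Set V := fun w => if w = w2 then insert d.snd (B w) else B w
    have hsub : ∀ w, B w ⊆ B' w := by
      intro w x hx
      by_cases h : w = w2 <;> simp [B', h]
      · right; exact h ▸ hx
      · exact hx
    have hB' : ∀ w x, x ∈ B' w → x ∈ B w ∨ (x = d.snd ∧ w = w2) := by
      intro w x hx
      by_cases h : w = w2
      · simp only [B', h, if_true] at hx
        rcases hx with hx | hx
        · exact Or.inr ⟨hx, h⟩
        · exact Or.inl (h ▸ hx)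
      · simp only [B', h, if_false] at hx
        exact Or.inl hx
    have hmem : d.snd ∈ B' w2 := by simp [B']
    have hU : (⋃ w, B' w)ᶜ = (⋃ w, B w)ᶜ \ {d.snd} := by
      ext x
      simp only [Set.mem_compl_iff, Set.mem_iUnion, Set.mem_sdiff, Set.mem_singleton_iff]
      constructor
      · intro h
        refine ⟨fun ⟨w, hw⟩ => h ⟨w, hsub w hw⟩, fun hx => h ⟨w2, hx ▸ hmem⟩⟩
      · rintro ⟨h1, h2⟩ ⟨w, hw⟩
        rcases hB' w x hw with h | ⟨h, -⟩
        · exact h1 ⟨w, h⟩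
        · exact h2 h
    obtain ⟨f, hf, hf'⟩ := ih B' (by
        rw [hU, Set.ncard_sdiff_singleton_of_mem hd2, hn]
        rfl)
      (fun w => hsub w (ha w))
      (by
        intro w w' x hx hx'
        rcases hB' w x hx with h | ⟨h, h1⟩ <;> rcases hB' w' x hx' with h' | ⟨h', h1'⟩
        · exact hd _ _ x h h'
        · exact absurd (h' ▸ h) (hd2' _)
        · exact absurd (h ▸ h') (hd2' _)
        · rw [h1, h1'])
      (by
        intro w x hx
        rcases hB' w x hx with h | ⟨rfl, rfl⟩
        · exact (hc w x h).mono (hsub w)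
        · exact (RI.adj d.adj.symm hmem (hsub _ hw2)).trans ((hc _ _ hw2).mono (hsub _)))
    exact ⟨f, fun w x hx => hf w x (hsub w hx), hf'⟩

/-- Parent functions decreasing the distance to the root in connected graphs. -/
lemma exists_parent {W : Type*} (K : SimpleGraph W) (hK : K.Connected) (w0 : W) :
    ∃ pT : W → W, pT w0 = w0 ∧
      ∀ w, w ≠ w0 → K.Adj w (pT w) ∧ K.dist (pT w) w0 < K.dist w w0 := by
  classical
  have : ∀ w, ∃ w', (w = w0 → w' = w0) ∧
      (w ≠ w0 → K.Adj w w' ∧ K.dist w' w0 < K.dist w w0) := by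
    intro w
    by_cases h : w = w0
    · exact ⟨w0, fun _ => rfl, fun h' => absurd h h'⟩
    · obtain ⟨q, hq⟩ := hK.exists_walk_length_eq_dist w w0
      cases q with
      | nil => exact absurd rfl h
      | @cons _ z _ hz q =>
        refine ⟨z, fun h' => absurd h' h, fun _ => ⟨hz, ?_⟩⟩
        have := dist_le q
        rw [Walk.length_cons] at hq
        omega
  choose pT h1 h2 using this
  exact ⟨pT, h1 w0 rfl, h2⟩

lemma tree_adj_parent {W : Type*} [Finite W] (K : SimpleGraph W) (hK : K.Connected)
    (hac : K.IsAcyclic) (w0 : W) (pT : W → W) (h0 : pT w0 = w0)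
    (hp : ∀ w, w ≠ w0 → K.Adj w (pT w) ∧ K.dist (pT w) w0 < K.dist w w0)
    (w w' : W) (h : K.Adj w w') : w' = pT w ∨ w = pT w' := by
  have ht := parGraph_isTree pT w0 (fun w => K.dist w w0) h0 (fun w hw => (hp w hw).2)
  have hle : parGraph pT ≤ K := by
    intro u v huv
    rw [parGraph, fromRel_adj] at huv
    obtain ⟨hne, h | h⟩ := huv
    · have : u ≠ w0 := by
        rintro rfl
        exact hne (h.trans h0).symm
      rw [h]
      exact (hp u this).1
    · have : v ≠ w0 := by
        rintro rfl
        exact hne (h.trans h0)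
      rw [h]
      exact (hp v this).1.symm
  have hmin := isTree_iff_minimal_connected.1 (⟨hK, hac⟩ : K.IsTree)
  have := hmin.2 ht.connected hle h
  rw [parGraph, fromRel_adj] at this
  exact this.2

lemma display_core {V W X : Type*} (N : PhyloGraph V X) (T : PhyloTree W X)
    (hdisp : Displays N T) (hW : Finite W) (hV : Finite V) :
    ∃ (r : V) (p : V → V) (f : V → W) (a : W → V) (rank : V → ℕ),
      p r = r ∧ (∀ v, v ≠ r → N.graph.Adj v (p v) ∧ rank (p v) < rank v) ∧
      (∀ x, f (N.leaf x) = T.leaf x) ∧ (∀ w, f (a w) = w) ∧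
      (∀ v, v ≠ a (f v) → v ≠ r ∧ f (p v) = f v) ∧
      (∀ w w', T.graph.Adj w w' → ∃ v, (f v = w ∧ f (p v) = w') ∨ (f v = w' ∧ f (p v) = w)) := by
  classical
  obtain ⟨S, -, e, he⟩ := hdisp
  obtain ⟨w0⟩ := T.connected.nonempty
  have : Nonempty W := ⟨w0⟩
  obtain ⟨pT, hp0, hpT⟩ := exists_parent T.graph T.connected w0
  obtain ⟨B, hB1, hB2, hB3, hB4⟩ := branch_sets S.coe T.graph e w0 pT
    (fun w => T.graph.dist w w0) hpT
  -- a root for every branch set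
  have hc : ∀ w, ∃ c ∈ B w, w ≠ w0 → S.coe.Adj c (e.symm (pT w)).1 := by
    intro w
    by_cases h : w = w0
    · exact ⟨_, hB1 w, fun h' => absurd h h'⟩
    · obtain ⟨c, hc, hc'⟩ := hB4 w h
      exact ⟨c, hc, fun _ => hc'⟩
  choose c hcB hcadj using hc
  have hCcov : ∀ w v, v ∈ (Subtype.val '' B w : Set V) →
      RI N.graph (Subtype.val '' B w) v (c w).1 := by
    rintro w _ ⟨x, hx, rfl⟩
    exact ((hB3 w x hx).trans (hB3 w _ (hcB w)).symm).map S.hom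
      (fun y hy => Set.mem_image_of_mem _ hy)
  obtain ⟨f, hf1, hf2⟩ := extend_sets N.graph N.connected (fun w => (c w).1) _
    (fun w => (Subtype.val '' B w : Set V)) rfl (fun w => Set.mem_image_of_mem _ (hcB w))
    (by
      rintro w w' _ ⟨x, hx, rfl⟩ ⟨y, hy, hxy⟩
      rw [Subtype.ext hxy] at hy
      exact hB2 w w' x hx hy)
    hCcov
  have hfa : ∀ w, f (c w).1 = w := fun w => hf1 w _ (Set.mem_image_of_mem _ (hcB w))
  have hfφ : ∀ w, f (e.symm w).1.1 = w := fun w => hf1 w _ (Set.mem_image_of_mem _ (hB1 w))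
  -- distances within the fibres
  have hex : ∀ v, ∃ n, ∃ q : N.graph.Walk v (c (f v)).1, (∀ x ∈ q.support, f x = f v) ∧
      q.length = n := fun v => by
    obtain ⟨q, hq⟩ := hf2 v
    exact ⟨_, q, hq, rfl⟩
  let d : V → ℕ := fun v => Nat.find (hex v)
  have hstep : ∀ v, ∃ v', v ≠ (c (f v)).1 →
      N.graph.Adj v v' ∧ f v' = f v ∧ d v' < d v := by
    intro v
    by_cases h : v = (c (f v)).1
    · exact ⟨v, fun h' => absurd h h'⟩
    · obtain ⟨q, hq, hl⟩ := Nat.find_spec (hex v)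
      have key : ∀ (u : V) (q : N.graph.Walk v u), u = (c (f v)).1 → (∀ x ∈ q.support, f x = f v) →
          q.length = d v → ∃ v', N.graph.Adj v v' ∧ f v' = f v ∧ d v' < d v := by
        intro u q hu hq hl
        cases q with
        | nil => exact absurd hu h
        | @cons _ z _ hz q =>
          have hfz : f z = f v := hq z (by simp)
          refine ⟨z, hz, hfz, ?_⟩
          have : d z ≤ q.length := by
            have hu' : u = (c (f z)).1 := by rw [hu, hfz]
            subst hu'
            exact Nat.find_min' (hex z) ⟨q, fun x hx => by
              rw [hfz]
              exact hq x (by simp [hx]), rfl⟩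
          rw [Walk.length_cons] at hl
          omega
      obtain ⟨v', hv'⟩ := key _ q rfl hq hl
      exact ⟨v', fun _ => hv'⟩
  choose g hg using hstep
  have hMex : ∃ M, ∀ v, d v < M := by
    have := Fintype.ofFinite V
    exact ⟨Finset.univ.sup d + 1, fun v => Nat.lt_succ_of_le (Finset.le_sup (Finset.mem_univ v))⟩
  obtain ⟨M, hM⟩ := hMex
  let p : V → V := fun v => if v = (c (f v)).1 then
    (if f v = w0 then v else (e.symm (pT (f v))).1.1) else g v
  let r : V := (c w0).1
  have hpa : ∀ w, w ≠ w0 → p (c w).1 = (e.symm (pT w)).1.1 := by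
    intro w hw
    simp only [p, hfa, if_true, hw, if_false]
  have hpn : ∀ v, v ≠ (c (f v)).1 → p v = g v := by
    intro v hv
    simp only [p, if_neg hv]
  refine ⟨r, p, f, fun w => (c w).1, fun v => T.graph.dist (f v) w0 * M + d v, ?_, ?_, ?_, hfa,
    ?_, ?_⟩
  · simp [p, r, hfa]
  · intro v hv
    by_cases h : v = (c (f v)).1
    · have hw : f v ≠ w0 := by
        intro h0
        rw [h0] at h
        exact hv h
      have hpv : p v = (e.symm (pT (f v))).1.1 := by
        conv_lhs => rw [h]
        exact hpa _ hw
      rw [hpv]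
      constructor
      · have := S.coe_adj_sub _ _ (hcadj (f v) hw)
        rwa [← h] at this
      · beta_reduce
        rw [hfφ]
        have h1 := (hpT _ hw).2
        have h2 := hM (e.symm (pT (f v))).1.1
        have h3 : (T.graph.dist (pT (f v)) w0 + 1) * M ≤ T.graph.dist (f v) w0 * M :=
          Nat.mul_le_mul_right _ h1
        rw [add_mul] at h3
        omega
    · rw [hpn v h]
      obtain ⟨h1, h2, h3⟩ := hg v h
      refine ⟨h1, ?_⟩
      beta_reduce
      rw [h2]
      omega
  · intro x
    rw [← he x, hfφ]
  · intro v hv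
    refine ⟨?_, ?_⟩
    · rintro rfl
      exact hv (by simp only [r, hfa])
    · rw [hpn v hv]
      exact (hg v hv).2.1
  · have key : ∀ w w', T.graph.Adj w w' → w' = pT w → f (c w).1 = w ∧ f (p (c w).1) = w' := by
      intro w w' h h'
      have hw : w ≠ w0 := by
        rintro rfl
        exact h.ne (h'.trans hp0).symm
      rw [hpa w hw, hfφ]
      exact ⟨hfa w, h'.symm⟩
    intro w w' h
    rcases tree_adj_parent T.graph T.connected T.acyclic w0 pT hp0 hpT w w' h with h' | h'
    · exact ⟨_, Or.inl (key w w' h h')⟩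
    · exact ⟨_, Or.inr (key w' w h.symm h')⟩

lemma exists_hasTD {V : Type*} [Finite V] [Nonempty V] (G : SimpleGraph V) :
    ∃ k, HasTreeDecompWidthLE G k := by
  classical
  have := Fintype.ofFinite V
  refine ⟨Fintype.card V, hasTD_of_type G _ (⊥ : SimpleGraph Unit) (fun _ => Finset.univ)
    IsTree.of_subsingleton ?_ ?_ ?_ ?_⟩
  · simp
  · simp
  · intro v i j _ _
    exact RI.refl (by simp)
  · simp [Finset.card_univ]

theorem part_one {V W X : Type*} (N : PhyloGraph V X) (T : PhyloTree W X)
    (hV : Finite V) (k : ℕ) (hk : HasTreeDecompWidthLE N.graph k)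
    (r : V) (p : V → V) (f : V → W) (a : W → V) (rank : V → ℕ)
    (hp : ∀ v, v ≠ r → N.graph.Adj v (p v) ∧ rank (p v) < rank v)
    (hleaf : ∀ x, f (N.leaf x) = T.leaf x) (hfa : ∀ w, f (a w) = w)
    (hfib : ∀ v, v ≠ a (f v) → v ≠ r ∧ f (p v) = f v)
    (hedge : ∀ w w', T.graph.Adj w w' →
      ∃ v, (f v = w ∧ f (p v) = w') ∨ (f v = w' ∧ f (p v) = w)) (hpr : p r = r) :
    HasTreeDecompWidthLE (displayGraph N.graph N.leaf T.graph T.leaf) (2 * k + 1) := by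
  classical
  obtain ⟨n, t, bag, ht, h1, h2, h3, h4⟩ := hk
  let bag' : Fin (n + 1) → Finset (V ⊕ W) := fun i =>
    (bag i).image Sum.inl ∪ (bag i).image (fun v => Sum.inr (f v))
  have hl : ∀ v i, Sum.inl v ∈ bag' i ↔ v ∈ bag i := by
    intro v i
    simp [bag']
  have hr : ∀ w i, Sum.inr w ∈ bag' i ↔ ∃ v ∈ bag i, f v = w := by
    intro w i
    simp [bag']
  have hcv : ∀ v i j, v ∈ bag i → v ∈ bag j → RI t {i | v ∈ bag i} i j := fun v i j hi hj =>
    RI.of_induce (h3 v).preconnected hi hj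
  refine hasTD_display _ _ _ _ N.leaf_inj _ t bag' ht ?_ ?_ ?_ ?_ ?_ ?_
  · rintro (v | w)
    · obtain ⟨i, hi⟩ := h1 v
      exact ⟨i, (hl v i).2 hi⟩
    · obtain ⟨i, hi⟩ := h1 (a w)
      exact ⟨i, (hr w i).2 ⟨a w, hi, hfa w⟩⟩
  · intro x
    obtain ⟨i, hi⟩ := h1 (N.leaf x)
    exact ⟨i, (hl _ i).2 hi, (hr _ i).2 ⟨_, hi, hleaf x⟩⟩
  · intro u v h
    obtain ⟨i, hi, hi'⟩ := h2 u v h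
    exact ⟨i, (hl _ _).2 hi, (hl _ _).2 hi'⟩
  · intro w w' h
    obtain ⟨v, hv⟩ := hedge w w' h
    have hvr : v ≠ r := by
      rintro rfl
      rw [hpr] at hv
      rcases hv with ⟨h1, h2⟩ | ⟨h1, h2⟩
      · exact h.ne (h1.symm.trans h2)
      · exact h.ne (h2.symm.trans h1)
    obtain ⟨i, hi, hi'⟩ := h2 _ _ (hp v hvr).1
    refine ⟨i, ?_⟩
    rcases hv with ⟨h1, h2⟩ | ⟨h1, h2⟩
    · exact ⟨(hr _ _).2 ⟨_, hi, h1⟩, (hr _ _).2 ⟨_, hi', h2⟩⟩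
    · exact ⟨(hr _ _).2 ⟨_, hi', h2⟩, (hr _ _).2 ⟨_, hi, h1⟩⟩
  · rintro (v | w) i j hi hj
    · simp only [hl] at hi hj ⊢
      exact hcv v i j hi hj
    · have hmono : ∀ v i j, f v = w → v ∈ bag i → v ∈ bag j →
          RI t {i | Sum.inr w ∈ bag' i} i j := fun v i j hv hi hj =>
        (hcv v i j hi hj).mono (fun m hm => (hr w m).2 ⟨v, hm, hv⟩)
      obtain ⟨m, hm⟩ := h1 (a w)
      have key : ∀ n v i, rank v = n → f v = w → v ∈ bag i →
          RI t {i | Sum.inr w ∈ bag' i} i m := by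
        intro n
        induction n using Nat.strong_induction_on with
        | _ n ih =>
          intro v i hn hv hi
          by_cases h : v = a (f v)
          · rw [hv] at h
            exact hmono v i m hv hi (h ▸ hm)
          · obtain ⟨hvr, hfv⟩ := hfib v h
            obtain ⟨j, hj, hj'⟩ := h2 _ _ (hp v hvr).1
            exact (hmono v i j hv hi hj).trans
              (ih _ (hn ▸ (hp v hvr).2) (p v) j rfl (hfv.trans hv) hj')
      obtain ⟨v, hv, hvw⟩ := (hr w i).1 hi
      obtain ⟨v', hv', hvw'⟩ := (hr w j).1 hj
      exact (key _ v i rfl hvw hv).trans (key _ v' j rfl hvw' hv').symm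
  · intro i
    have h5 := h4 i
    have h6 : (bag' i).card ≤ _ := Finset.card_union_le _ _
    have h7 := Finset.card_image_le (s := bag i) (f := (Sum.inl : V → V ⊕ W))
    have h8 := Finset.card_image_le (s := bag i) (f := fun v => (Sum.inr (f v) : V ⊕ W))
    omega

theorem part_two {V W X : Type*} (N : PhyloGraph V X) (T : PhyloTree W X)
    (hV : Finite V)
    (r : V) (p : V → V) (f : V → W) (a : W → V) (rank : V → ℕ)
    (hp : ∀ v, v ≠ r → N.graph.Adj v (p v) ∧ rank (p v) < rank v)
    (hleaf : ∀ x, f (N.leaf x) = T.leaf x) (hfa : ∀ w, f (a w) = w)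
    (hfib : ∀ v, v ≠ a (f v) → v ≠ r ∧ f (p v) = f v)
    (hedge : ∀ w w', T.graph.Adj w w' →
      ∃ v, (f v = w ∧ f (p v) = w') ∨ (f v = w' ∧ f (p v) = w)) (hpr : p r = r) :
    HasTreeDecompWidthLE (displayGraph N.graph N.leaf T.graph T.leaf) (reticNumber N + 2) := by
  classical
  have := Fintype.ofFinite V
  -- the spanning tree and the extra edges
  have htree := parGraph_isTree p r rank hpr (fun v hv => (hp v hv).2)
  have hle : parGraph p ≤ N.graph := by
    intro u v huv
    rw [parGraph, fromRel_adj] at huv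
    obtain ⟨hne, h | h⟩ := huv
    · have : u ≠ r := by
        rintro rfl
        exact hne (h.trans hpr).symm
      rw [h]
      exact (hp u this).1
    · have : v ≠ r := by
        rintro rfl
        exact hne (h.trans hpr)
      rw [h]
      exact (hp v this).1.symm
  obtain ⟨F, hFcard, hF⟩ : ∃ F : Finset V, F.card ≤ reticNumber N ∧
      ∀ u v, N.graph.Adj u v → ¬ (parGraph p).Adj u v → u ∈ F ∨ v ∈ F := by
    have hfin : (N.graph.edgeSet \ (parGraph p).edgeSet).Finite := Set.toFinite _
    refine ⟨hfin.toFinset.image (fun e => (Quot.out e).1), ?_, ?_⟩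
    · refine Finset.card_image_le.trans ?_
      rw [← Set.ncard_eq_toFinset_card _ hfin]
      rw [Set.ncard_sdiff (edgeSet_mono hle) (Set.toFinite _), reticNumber]
      have := (isTree_iff_connected_and_card.1 htree).2
      have h4 : Nat.card (parGraph p).edgeSet = (parGraph p).edgeSet.ncard := rfl
      omega
    · intro u v h h'
      have hm : (Quot.out s(u, v)).1 ∈ hfin.toFinset.image (fun e => (Quot.out e).1) :=
        Finset.mem_image_of_mem _ (hfin.mem_toFinset.2 ⟨h, h'⟩)
      have : (Quot.out s(u, v)).1 ∈ s(u, v) := Sym2.out_fst_mem _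
      rw [Sym2.mem_iff] at this
      rcases this with h | h
      · left; rwa [h] at hm
      · right; rwa [h] at hm
  -- the decomposition tree
  let P : V × Bool → V × Bool := fun i =>
    if i.2 then (if i.1 = r then i else (p i.1, false)) else (i.1, true)
  let t := parGraph P
  have ht : t.IsTree := by
    refine parGraph_isTree P (r, true) (fun i => if i.2 then 2 * rank i.1 else 2 * rank i.1 + 1)
      (by simp [P]) ?_
    rintro ⟨v, b⟩ hv
    cases b
    · simp [P]
    · have hvr : v ≠ r := by
        rintro rfl
        exact hv rfl
      have := (hp v hvr).2
      simp only [P, if_true, if_neg hvr]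
      simp
      omega
  have hadj1 : ∀ v, t.Adj (v, false) (v, true) := by
    intro v
    have : P (v, false) = (v, true) := by simp [P]
    rw [← this]
    exact parGraph_adj (by simp [P])
  have hadj2 : ∀ v, t.Adj (v, true) (p v, false) := by
    intro v
    by_cases h : v = r
    · rw [h, hpr]
      exact (hadj1 r).symm
    · have : P (v, true) = (p v, false) := by simp [P, h]
      rw [← this]
      exact parGraph_adj (by simp [P, h])
  let bag : V × Bool → Finset (V ⊕ W) := fun i =>
    (if i.2 then {Sum.inl (p i.1), Sum.inr (f i.1), Sum.inr (f (p i.1))}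
      else {Sum.inl i.1, Sum.inl (p i.1), Sum.inr (f i.1)}) ∪ F.image Sum.inl
  have hlF : ∀ u v, Sum.inl u ∈ bag (v, false) ↔ u = v ∨ u = p v ∨ u ∈ F := by
    intro u v
    simp [bag, or_assoc]
  have hlT : ∀ u v, Sum.inl u ∈ bag (v, true) ↔ u = p v ∨ u ∈ F := by
    intro u v
    simp [bag]
  have hrF : ∀ w v, Sum.inr w ∈ bag (v, false) ↔ w = f v := by
    intro u v
    simp [bag]
  have hrT : ∀ w v, Sum.inr w ∈ bag (v, true) ↔ w = f v ∨ w = f (p v) := by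
    intro u v
    simp [bag]
  refine hasTD_display _ _ _ _ N.leaf_inj _ t bag ht ?_ ?_ ?_ ?_ ?_ ?_
  · rintro (v | w)
    · exact ⟨(v, false), (hlF _ _).2 (Or.inl rfl)⟩
    · exact ⟨(a w, false), (hrF _ _).2 (hfa w).symm⟩
  · intro x
    exact ⟨(N.leaf x, false), (hlF _ _).2 (Or.inl rfl), (hrF _ _).2 (hleaf x).symm⟩
  · intro u v h
    by_cases h' : (parGraph p).Adj u v
    · rw [parGraph, fromRel_adj] at h'
      rcases h'.2 with h | h
      · exact ⟨(u, false), (hlF _ _).2 (Or.inl rfl), (hlF _ _).2 (Or.inr (Or.inl h))⟩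
      · exact ⟨(v, false), (hlF _ _).2 (Or.inr (Or.inl h)), (hlF _ _).2 (Or.inl rfl)⟩
    · rcases hF u v h h' with hh | hh
      · exact ⟨(v, false), (hlF _ _).2 (Or.inr (Or.inr hh)), (hlF _ _).2 (Or.inl rfl)⟩
      · exact ⟨(u, false), (hlF _ _).2 (Or.inl rfl), (hlF _ _).2 (Or.inr (Or.inr hh))⟩
  · intro w w' h
    obtain ⟨v, ⟨h1, h2⟩ | ⟨h1, h2⟩⟩ := hedge w w' h
    · exact ⟨(v, true), (hrT _ _).2 (Or.inl h1.symm), (hrT _ _).2 (Or.inr h2.symm)⟩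
    · exact ⟨(v, true), (hrT _ _).2 (Or.inr h2.symm), (hrT _ _).2 (Or.inl h1.symm)⟩
  · rintro (v | w) i j hi hj
    · by_cases hvF : v ∈ F
      · obtain ⟨q⟩ := ht.connected.preconnected i j
        refine ⟨q, ?_⟩
        rintro ⟨u, b⟩ -
        cases b
        · exact (hlF _ _).2 (Or.inr (Or.inr hvF))
        · exact (hlT _ _).2 (Or.inr hvF)
      · have hT : ∀ u, v = p u → RI t {i | Sum.inl v ∈ bag i} (u, true) (v, false) := by
          intro u hu
          have := hadj2 u
          rw [← hu] at this
          exact RI.adj this ((hlT _ _).2 (Or.inl hu)) ((hlF _ _).2 (Or.inl rfl))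
        have key : ∀ i, Sum.inl v ∈ bag i → RI t {i | Sum.inl v ∈ bag i} i (v, false) := by
          rintro ⟨u, b⟩ hi
          cases b
          · rcases (hlF _ _).1 hi with rfl | h | h
            · exact RI.refl hi
            · exact (RI.adj (hadj1 u) hi ((hlT _ _).2 (Or.inl h))).trans (hT u h)
            · exact absurd h hvF
          · rcases (hlT _ _).1 hi with h | h
            · exact hT u h
            · exact absurd h hvF
        exact (key i hi).trans (key j hj).symm
    · have key : ∀ n v, rank v = n → w = f v →
          RI t {i | Sum.inr w ∈ bag i} (v, false) (a w, false) := by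
        intro n
        induction n using Nat.strong_induction_on with
        | _ n ih =>
          intro v hn hv
          by_cases h : v = a (f v)
          · rw [← hv] at h
            rw [← h]
            exact RI.refl ((hrF _ _).2 hv)
          · obtain ⟨hvr, hfv⟩ := hfib v h
            have hv' : w = f (p v) := hv.trans hfv.symm
            exact ((RI.adj (hadj1 v) ((hrF _ _).2 hv) ((hrT _ _).2 (Or.inl hv))).trans
              (RI.adj (hadj2 v) ((hrT _ _).2 (Or.inl hv)) ((hrF _ _).2 hv'))).trans
              (ih _ (hn ▸ (hp v hvr).2) (p v) rfl hv')
      have key2 : ∀ i, Sum.inr w ∈ bag i → RI t {i | Sum.inr w ∈ bag i} i (a w, false) := by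
        rintro ⟨u, b⟩ hi
        cases b
        · exact key _ u rfl ((hrF _ _).1 hi)
        · rcases (hrT _ _).1 hi with h | h
          · exact (RI.adj (hadj1 u).symm hi ((hrF _ _).2 h)).trans (key _ u rfl h)
          · exact (RI.adj (hadj2 u) hi ((hrF _ _).2 h)).trans (key _ (p u) rfl h)
      exact (key2 i hi).trans (key2 j hj).symm
  · rintro ⟨v, b⟩
    have h6 := Finset.card_image_le (s := F) (f := (Sum.inl : V → V ⊕ W))
    refine (Finset.card_union_le _ _).trans ?_
    cases b
    · have h7 := Finset.card_le_three (a := (Sum.inl v : V ⊕ W)) (b := Sum.inl (p v))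
        (c := Sum.inr (f v))
      simp only [Bool.false_eq_true, if_false]
      omega
    · have h7 := Finset.card_le_three (a := (Sum.inl (p v) : V ⊕ W)) (b := Sum.inr (f v))
        (c := Sum.inr (f (p v)))
      simp only [if_true]
      omega

/-- If an unrooted binary phylogenetic network `N` displays an unrooted binary
phylogenetic tree `T` on the same label set `X` with `|X| ≥ 3`, then
`tw(D(N,T)) ≤ min{2·tw(N) + 1, r(N) + 2}`. -/
theorem treewidth_display_le_min {V W X : Type*}
    (N : PhyloGraph V X) (T : PhyloTree W X) (hX : 3 ≤ Nat.card X)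
    (hdisp : Displays N T) :
    treewidth (displayGraph N.graph N.leaf T.graph T.leaf) ≤
      min (2 * treewidth N.graph + 1) (reticNumber N + 2) := by

  have hV : Finite V := N.finite
  have hW : Finite W := T.finite
  have hne : Nonempty V := N.connected.nonempty
  obtain ⟨r, p, f, a, rank, hpr, hp, hleaf, hfa, hfib, hedge⟩ := display_core N T hdisp hW hV
  have hk : HasTreeDecompWidthLE N.graph (treewidth N.graph) :=
    Nat.sInf_mem (s := {k | HasTreeDecompWidthLE N.graph k}) (exists_hasTD N.graph)
  refine le_min (Nat.sInf_le ?_) (Nat.sInf_le ?_)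
  · exact part_one N T hV _ hk r p f a rank hp hleaf hfa hfib hedge hpr
  · exact part_two N T hV r p f a rank hp hleaf hfa hfib hedge hpr
end

section
/- Let N1 and N2 be two unrooted binary phylogenetic networks on the same label set X with |X| ≥ 3, and suppose that there exists an unrooted binary phylogenetic tree T on X that is displayed by both N1 and N2. Then tw(D(N1,N2)) ≤ r(N1) + r(N2) + 2, where r(N) = |E(N)| − (|V(N)| − 1) is the reticulation number. -/
open SimpleGraph

/-- Attaching a new last node to a tree on `Fin (n+1)`. -/
def addLeaf {n : ℕ} (t : SimpleGraph (Fin (n + 1))) (i0 : Fin (n + 1)) :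
    SimpleGraph (Fin (n + 2)) :=
  t.map Fin.castSuccEmb ⊔ edge (Fin.last (n + 1)) (Fin.castSucc i0)

lemma addLeaf_hom_adj {n : ℕ} (t : SimpleGraph (Fin (n + 1))) (i0 : Fin (n + 1))
    {a b : Fin (n + 1)} (h : t.Adj a b) : (addLeaf t i0).Adj a.castSucc b.castSucc := by
  left
  exact (SimpleGraph.map_adj_apply (f := Fin.castSuccEmb)).2 h

lemma addLeaf_adj_last {n : ℕ} (t : SimpleGraph (Fin (n + 1))) (i0 : Fin (n + 1)) :
    (addLeaf t i0).Adj i0.castSucc (Fin.last (n + 1)) := by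
  right
  rw [edge_adj]
  exact ⟨Or.inr ⟨rfl, rfl⟩, (Fin.castSucc_lt_last i0).ne⟩

lemma addLeaf_isTree {n : ℕ} (t : SimpleGraph (Fin (n + 1))) (i0 : Fin (n + 1))
    (ht : t.IsTree) : (addLeaf t i0).IsTree := by
  have h0 := isTree_iff_connected_and_card.1 ht
  rw [isTree_iff_connected_and_card]
  constructor
  · let f : t →g addLeaf t i0 := ⟨Fin.castSucc, fun h => addLeaf_hom_adj t i0 h⟩
    have key : ∀ x, (addLeaf t i0).Reachable i0.castSucc x := by
      intro x
      induction x using Fin.lastCases with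
      | last => exact (addLeaf_adj_last t i0).reachable
      | cast j => exact (ht.connected.preconnected i0 j).map f
    exact { preconnected := fun x y => (key x).symm.trans (key y), nonempty := ⟨0⟩ }
  · have hE : (addLeaf t i0).edgeSet =
        insert s(Fin.last (n + 1), Fin.castSucc i0) (Fin.castSuccEmb.sym2Map '' t.edgeSet) := by
      unfold addLeaf
      rw [edgeSet_sup, edgeSet_map, edgeSet_edge_of_ne (Fin.castSucc_lt_last i0).ne', Set.union_comm]
      rfl
    rw [Nat.card_coe_set_eq] at h0 ⊢
    rw [hE, Set.ncard_insert_of_notMem, Set.ncard_image_of_injective _ (Function.Embedding.injective _),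
      h0.2]
    · simp
    · rintro ⟨e, -, he⟩
      induction e using Sym2.ind with
      | _ a b =>
        have hl : Fin.last (n + 1) ∈ s(a.castSucc, b.castSucc) := by
          have : s(a.castSucc, b.castSucc) = s(Fin.last (n + 1), Fin.castSucc i0) := he
          rw [this]; simp
        rw [Sym2.mem_iff] at hl
        rcases hl with h | h
        · exact (Fin.castSucc_lt_last a).ne h.symm
        · exact (Fin.castSucc_lt_last b).ne h.symm

lemma addLeaf_induce_old {n : ℕ} (t : SimpleGraph (Fin (n + 1))) (i0 : Fin (n + 1))
    (s : Set (Fin (n + 1))) (hs : (t.induce s).Connected) :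
    ((addLeaf t i0).induce (Fin.castSucc '' s)).Connected := by
  let f : t.induce s →g (addLeaf t i0).induce (Fin.castSucc '' s) :=
    ⟨fun x => ⟨x.1.castSucc, x.1, x.2, rfl⟩, fun h => addLeaf_hom_adj t i0 h⟩
  refine hs.map f ?_
  rintro ⟨_, x, hx, rfl⟩
  exact ⟨⟨x, hx⟩, rfl⟩

/-- A tree decomposition with bags of size at most 3 of the vertex set `U`, in which every
pair related by `R` lies in a common bag. -/
def PartTD {D : Type*} (U : Set D) (R : D → D → Prop) : Prop :=
  ∃ (n : ℕ) (t : SimpleGraph (Fin (n + 1))) (bag : Fin (n + 1) → Finset D),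
    t.IsTree ∧
    (∀ i, ∀ v ∈ bag i, v ∈ U) ∧
    (∀ v ∈ U, (t.induce {i | v ∈ bag i}).Connected) ∧
    (∀ i, (bag i).card ≤ 3) ∧
    (∀ a b, R a b → ∃ i, a ∈ bag i ∧ b ∈ bag i)

lemma PartTD.start {D : Type*} (a b : D) :
    PartTD {a, b} (fun x y => x ∈ ({a, b} : Set D) ∧ y ∈ ({a, b} : Set D)) := by
  classical
  refine ⟨0, ⊥, fun _ => {a, b}, ?_, ?_, ?_, ?_, ?_⟩
  · have : Subsingleton (Fin (0 + 1)) := inferInstanceAs (Subsingleton (Fin 1))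
    exact IsTree.of_subsingleton
  · simp
  · intro v hv
    have : Subsingleton (Fin (0 + 1)) := inferInstanceAs (Subsingleton (Fin 1))
    refine { preconnected := ?_, nonempty := ⟨⟨0, by simpa using hv⟩⟩ }
    intro x y
    rw [Subsingleton.elim x y]
  · intro i
    exact Finset.card_le_two.trans (by norm_num)
  · rintro x y ⟨hx, hy⟩
    exact ⟨0, by simpa using hx, by simpa using hy⟩

lemma PartTD.refl {D : Type*} {U : Set D} {R : D → D → Prop} (h : PartTD U R) :
    PartTD U (fun x y => R x y ∨ (x = y ∧ x ∈ U)) := by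
  obtain ⟨n, t, bag, h1, h2, h3, h4, h5⟩ := h
  refine ⟨n, t, bag, h1, h2, h3, h4, ?_⟩
  rintro a b (h | ⟨rfl, h⟩)
  · exact h5 a b h
  · obtain ⟨i, hi⟩ := (h3 a h).nonempty
    exact ⟨i, hi, hi⟩

lemma PartTD.mem {D : Type*} {U : Set D} {R : D → D → Prop} (h : PartTD U R) {a b : D}
    (hab : R a b) : a ∈ U ∧ b ∈ U := by
  obtain ⟨n, t, bag, h1, h2, h3, h4, h5⟩ := h
  obtain ⟨i, ha, hb⟩ := h5 a b hab
  exact ⟨h2 i a ha, h2 i b hb⟩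

lemma PartTD.step {D : Type*} {U : Set D} {R : D → D → Prop} (h : PartTD U R) {a b v : D}
    (hab : R a b) (hv : v ∉ U) :
    PartTD (insert v U) (fun x y => R x y ∨
      (x ∈ ({v, a, b} : Set D) ∧ y ∈ ({v, a, b} : Set D))) := by
  classical
  obtain ⟨n, t, bag, h1, h2, h3, h4, h5⟩ := h
  obtain ⟨i0, ha, hb⟩ := h5 a b hab
  let bag' : Fin (n + 2) → Finset D := Fin.lastCases {v, a, b} bag
  have bl : bag' (Fin.last (n + 1)) = {v, a, b} := by simp [bag']
  have bc : ∀ i : Fin (n + 1), bag' i.castSucc = bag i := by intro i; simp [bag']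
  have hvb : ∀ i, v ∉ bag i := fun i hi => hv (h2 i v hi)
  refine ⟨n + 1, addLeaf t i0, bag', addLeaf_isTree t i0 h1, ?_, ?_, ?_, ?_⟩
  · intro i x hx
    induction i using Fin.lastCases with
    | last =>
      rw [bl] at hx
      simp only [Finset.mem_insert, Finset.mem_singleton] at hx
      rcases hx with rfl | rfl | rfl
      · exact Set.mem_insert _ _
      · exact Set.mem_insert_of_mem _ (h2 _ _ ha)
      · exact Set.mem_insert_of_mem _ (h2 _ _ hb)
    | cast j =>
      rw [bc] at hx
      exact Set.mem_insert_of_mem _ (h2 _ _ hx)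
  · intro x hx
    have hsing : ((addLeaf t i0).induce {Fin.last (n + 1)}).Connected := by
      refine { preconnected := ?_, nonempty := ⟨⟨_, rfl⟩⟩ }
      rintro ⟨y, rfl⟩ ⟨z, rfl⟩
      exact Reachable.refl _
    by_cases hxU : x ∈ U
    · have hold := addLeaf_induce_old t i0 _ (h3 x hxU)
      have hxv : x ≠ v := fun h => hv (h ▸ hxU)
      by_cases hxab : x = a ∨ x = b
      · have : {i | x ∈ bag' i} = Fin.castSucc '' {i | x ∈ bag i} ∪ {Fin.last (n + 1)} := by
          ext i
          induction i using Fin.lastCases with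
          | last => simp [bl, hxab]
          | cast j => simp [bc, (Fin.castSucc_lt_last j).ne]
        rw [this]
        refine connected_induce_union hold.preconnected hsing.preconnected
          (v := i0.castSucc) (w := Fin.last (n + 1)) ⟨i0, ?_, rfl⟩ rfl (addLeaf_adj_last t i0)
        rcases hxab with rfl | rfl
        · exact ha
        · exact hb
      · have : {i | x ∈ bag' i} = Fin.castSucc '' {i | x ∈ bag i} := by
          ext i
          induction i using Fin.lastCases with
          | last => simp [bl, hxab, hxv]
          | cast j => simp [bc]
        rw [this]
        exact hold
    · have hxv : x = v := by
        rcases hx with h | h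
        · exact h
        · exact absurd h hxU
      subst hxv
      have : {i | x ∈ bag' i} = {Fin.last (n + 1)} := by
        ext i
        induction i using Fin.lastCases with
        | last => simp [bl]
        | cast j => simp [bc, (Fin.castSucc_lt_last j).ne, hvb]
      rw [this]
      exact hsing
  · intro i
    induction i using Fin.lastCases with
    | last => rw [bl]; exact Finset.card_le_three
    | cast j => rw [bc]; exact h4 j
  · rintro x y (h | ⟨hx, hy⟩)
    · obtain ⟨i, hx, hy⟩ := h5 x y h
      exact ⟨i.castSucc, by rwa [bc], by rwa [bc]⟩
    · exact ⟨Fin.last _, by rw [bl]; simpa using hx, by rw [bl]; simpa using hy⟩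

lemma PartTD.step' {D : Type*} {U : Set D} {R : D → D → Prop} (h : PartTD U R) {a b v : D}
    (hab : R a b) (hv : v ∉ U ∨ v = a) :
    PartTD (insert v U) (fun x y => R x y ∨
      (x ∈ ({v, a, b} : Set D) ∧ y ∈ ({v, a, b} : Set D))) := by
  by_cases hvU : v ∈ U
  · have hva : v = a := hv.resolve_left (fun h => h hvU)
    subst hva
    rw [Set.insert_eq_of_mem hvU]
    obtain ⟨n, t, bag, h1, h2, h3, h4, h5⟩ := h
    refine ⟨n, t, bag, h1, h2, h3, h4, ?_⟩
    rintro x y (h | ⟨hx, hy⟩)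
    · exact h5 x y h
    · obtain ⟨i, ha, hb⟩ := h5 _ _ hab
      refine ⟨i, ?_, ?_⟩
      · rcases hx with rfl | rfl | rfl <;> assumption
      · rcases hy with rfl | rfl | rfl <;> assumption
  · exact h.step hab hvU

lemma PartTD.symm {D : Type*} {U : Set D} {R : D → D → Prop} (h : PartTD U R) :
    PartTD U (fun x y => R x y ∨ R y x) := by
  obtain ⟨n, t, bag, h1, h2, h3, h4, h5⟩ := h
  refine ⟨n, t, bag, h1, h2, h3, h4, ?_⟩
  rintro a b (h | h)
  · exact h5 a b h
  · obtain ⟨i, hi, hj⟩ := h5 b a h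
    exact ⟨i, hj, hi⟩

/-- The subgraph of edges of `G` covered by the relation `R`. -/
def Cov {V D : Type*} (G : SimpleGraph V) (i : V → D) (R : D → D → Prop) : SimpleGraph V where
  Adj u v := G.Adj u v ∧ (R (i u) (i v) ∨ R (i v) (i u))
  symm := ⟨fun _ _ h => ⟨h.1.symm, h.2.symm⟩⟩
  loopless := ⟨fun _ h => h.1.ne rfl⟩

lemma Cov.mono {V D : Type*} {G H : SimpleGraph V} {i : V → D} {R R' : D → D → Prop}
    (h : H ≤ G) (hR : ∀ x y, R x y → R' x y) : Cov H i R ≤ Cov G i R' :=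
  fun _ _ hab => ⟨h hab.1, hab.2.imp (hR _ _) (hR _ _)⟩

lemma walk_step {V D : Type*} {H : SimpleGraph V} {i : V → D} (hi : Function.Injective i)
    {u z : V} (p : H.Walk u z) (hp : p.IsPath) (b : D) (U : Set D) (R : D → D → Prop)
    (hP : PartTD U R) (hb : R b (i u))
    (hf : ∀ x ∈ p.support, x ≠ u → i x ∉ U ∨ i x = b) :
    ∃ R' : D → D → Prop, (∀ x y, R x y → R' x y) ∧
      PartTD (U ∪ i '' {x | x ∈ p.support}) R' ∧ R' b (i z) ∧
      ∀ x ∈ p.support, (Cov H i R').Reachable u x := by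
  induction p generalizing U R with
  | @nil u =>
    refine ⟨R, fun _ _ h => h, ?_, hb, ?_⟩
    · have : U ∪ i '' {x | x ∈ (Walk.nil : H.Walk u u).support} = U := by
        simp [(hP.mem hb).2]
      rwa [this]
    · intro x hx
      simp only [Walk.support_nil, List.mem_singleton] at hx
      rw [hx]
  | @cons u v z h p ih =>
    rw [Walk.cons_isPath_iff] at hp
    have hvu : v ≠ u := h.ne'
    have hs := hP.step' hb (hf v (by simp) hvu)
    obtain ⟨R', hR', hP', hbz, hr⟩ := ih hp.1 _ _ hs (Or.inr ⟨by simp, by simp⟩) (by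
      intro x hx hxv
      have hxu : x ≠ u := fun hh => hp.2 (hh ▸ hx)
      rcases hf x (by simp [hx]) hxu with h1 | h1
      · left
        rintro (h2 | h2)
        · exact hxv (hi h2)
        · exact h1 h2
      · exact Or.inr h1)
    refine ⟨R', fun x y hxy => hR' _ _ (Or.inl hxy), ?_, hbz, ?_⟩
    · have hu : i u ∈ U := (hP.mem hb).2
      have : U ∪ i '' {x | x ∈ (Walk.cons h p).support} =
          insert (i v) U ∪ i '' {x | x ∈ p.support} := by
        ext y
        simp only [Walk.support_cons, List.mem_cons, Set.mem_union, Set.mem_image,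
          Set.mem_ofPred_eq, Set.mem_insert_iff]
        constructor
        · rintro (h | ⟨x, rfl | hx, rfl⟩)
          · exact Or.inl (Or.inr h)
          · exact Or.inl (Or.inr hu)
          · exact Or.inr ⟨x, hx, rfl⟩
        · rintro ((rfl | h) | ⟨x, hx, rfl⟩)
          · exact Or.inr ⟨v, Or.inr p.start_mem_support, rfl⟩
          · exact Or.inl h
          · exact Or.inr ⟨x, Or.inr hx, rfl⟩
      rwa [this]
    · intro x hx
      rw [Walk.support_cons, List.mem_cons] at hx
      rcases hx with rfl | hx
      · exact Reachable.refl _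
      · refine Reachable.trans (Adj.reachable ?_) (hr x hx)
        exact ⟨h, Or.inl (hR' _ _ (Or.inr ⟨by simp, by simp⟩))⟩

/-- A path of `H` realizing an edge of the displayed tree. -/
def GoodPath {V W : Type*} (H : SimpleGraph V) (b : W → V) (w w' : W)
    (p : H.Walk (b w) (b w')) : Prop :=
  p.IsPath ∧ ∀ x ∈ p.support, x = b w ∨ x = b w' ∨
    (x ∉ Set.range b ∧ ∀ y, H.Adj x y → y ∈ p.support)

/-- The invariant on one side. -/
structure Side {V D W : Type*} (N H : SimpleGraph V) (i : V → D) (b : W → V) (w0 : W)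
    (Q : Set W) (U : Set V) (R : D → D → Prop) : Prop where
  branch : ∀ w ∈ Q, b w ∈ U
  closed : ∀ u ∈ U, (∃ w ∈ Q, b w = u) ∨ (u ∉ Set.range b ∧ ∀ y, H.Adj u y → y ∈ U)
  conn : ∀ u ∈ U, (Cov N i R).Reachable (b w0) u

lemma Side.mem_branch {V D W : Type*} {N H : SimpleGraph V} {i : V → D} {b : W → V} {w0 : W}
    {Q : Set W} {U : Set V} {R : D → D → Prop} (hS : Side N H i b w0 Q U R)
    (hb : Function.Injective b) {w : W} (h : b w ∈ U) : w ∈ Q := by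
  rcases hS.closed _ h with ⟨w', h1, h2⟩ | ⟨h1, -⟩
  · exact hb h2 ▸ h1
  · exact absurd ⟨w, rfl⟩ h1

lemma avoid_aux {V : Type*} {H : SimpleGraph V} {U B : Set V}
    (hU : ∀ u ∈ U, u ∉ B → ∀ y, H.Adj u y → y ∈ U) {v z : V} (p : H.Walk v z)
    (hp : ∀ y ∈ p.support, y = z ∨ y ∉ B) (hz : z ∉ U) (hz' : z ∈ B) :
    ∀ y ∈ p.support, y ∉ U := by
  induction p with
  | nil => simpa using hz
  | @cons u v z h p ih =>
    have ih' := ih (fun y hy => hp y (by simp [hy])) hz hz'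
    intro y hy
    rw [Walk.support_cons, List.mem_cons] at hy
    rcases hy with rfl | hy
    · intro hyU
      rcases hp y (by simp) with rfl | h1
      · exact hz hyU
      · exact ih' v p.start_mem_support (hU y hyU h1 v h)
    · exact ih' y hy

lemma Side.fresh {V D W : Type*} {N H : SimpleGraph V} {i : V → D} {b : W → V} {w0 : W}
    {Q : Set W} {U : Set V} {R : D → D → Prop} (hS : Side N H i b w0 Q U R)
    (hb : Function.Injective b) {w w' : W} (hw' : w' ∉ Q)
    (p : H.Walk (b w) (b w')) (hp : GoodPath H b w w' p) :
    ∀ x ∈ p.support, x ≠ b w → x ∉ U := by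
  have hz : b w' ∉ U := fun h => hw' (hS.mem_branch hb h)
  obtain ⟨h1, h2⟩ := hp
  have hU : ∀ u ∈ U, u ∉ Set.range b → ∀ y, H.Adj u y → y ∈ U := by
    intro u hu hur
    rcases hS.closed u hu with ⟨w', -, h⟩ | ⟨-, h⟩
    · exact absurd ⟨w', h⟩ hur
    · exact h
  have h2' : ∀ x ∈ p.support, x = b w ∨ x = b w' ∨ x ∉ Set.range b :=
    fun x hx => (h2 x hx).imp_right (fun h => h.imp_right And.left)
  have hr : b w' ∈ Set.range b := ⟨w', rfl⟩
  clear h2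
  generalize b w' = z at *
  cases p with
  | nil => intro x hx hne; simp at hx; exact absurd hx hne
  | cons h q =>
    rw [Walk.cons_isPath_iff] at h1
    intro x hx hne
    rw [Walk.support_cons, List.mem_cons] at hx
    refine avoid_aux hU q ?_ hz hr x (hx.resolve_left hne)
    intro y hy
    rcases h2' y (by simp [hy]) with h | h
    · exact absurd (h ▸ hy) h1.2
    · exact h

lemma Side.extend {V D W : Type*} {N H : SimpleGraph V} {i : V → D} {b : W → V} {w0 : W}
    {Q : Set W} {U : Set V} {R R' : D → D → Prop} (hS : Side N H i b w0 Q U R)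
    (hHN : H ≤ N) (hR : ∀ x y, R x y → R' x y) {w w' : W} (hw : w ∈ Q)
    (p : H.Walk (b w) (b w')) (hp : GoodPath H b w w' p)
    (hr : ∀ x ∈ p.support, (Cov H i R').Reachable (b w) x) :
    Side N H i b w0 (insert w' Q) (U ∪ {x | x ∈ p.support}) R' := by
  have c1 : ∀ u ∈ U, (Cov N i R').Reachable (b w0) u :=
    fun u hu => (hS.conn u hu).mono (Cov.mono le_rfl hR)
  refine ⟨?_, ?_, ?_⟩
  · rintro x (rfl | hx)
    · exact Or.inr p.end_mem_support
    · exact Or.inl (hS.branch x hx)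
  · rintro u (hu | hu)
    · rcases hS.closed u hu with ⟨x, hx, h⟩ | ⟨h1, h2⟩
      · exact Or.inl ⟨x, Or.inr hx, h⟩
      · exact Or.inr ⟨h1, fun y hy => Or.inl (h2 y hy)⟩
    · rcases hp.2 u hu with rfl | rfl | ⟨h1, h2⟩
      · exact Or.inl ⟨w, Or.inr hw, rfl⟩
      · exact Or.inl ⟨w', Or.inl rfl, rfl⟩
      · exact Or.inr ⟨h1, fun y hy => Or.inr (h2 y hy)⟩
  · rintro u (hu | hu)
    · exact c1 u hu
    · exact (c1 _ (hS.branch w hw)).trans ((hr u hu).mono (Cov.mono hHN (fun _ _ h => h)))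

/-- The full invariant. -/
def PairInv {V1 V2 D W : Type*} (N1 H1 : SimpleGraph V1) (N2 H2 : SimpleGraph V2)
    (i1 : V1 → D) (i2 : V2 → D) (b1 : W → V1) (b2 : W → V2) (w0 : W) (Q : Set W) : Prop :=
  ∃ (U1 : Set V1) (U2 : Set V2) (R : D → D → Prop),
    Side N1 H1 i1 b1 w0 Q U1 R ∧ Side N2 H2 i2 b2 w0 Q U2 R ∧
    PartTD (i1 '' U1 ∪ i2 '' U2) R ∧ ∀ w ∈ Q, R (i1 (b1 w)) (i2 (b2 w))

lemma PairInv.start {V1 V2 D W : Type*} (N1 H1 : SimpleGraph V1) (N2 H2 : SimpleGraph V2)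
    (i1 : V1 → D) (i2 : V2 → D) (b1 : W → V1) (b2 : W → V2) (w0 : W) :
    PairInv N1 H1 N2 H2 i1 i2 b1 b2 w0 {w0} := by
  refine ⟨{b1 w0}, {b2 w0}, fun x y => x ∈ ({i1 (b1 w0), i2 (b2 w0)} : Set D) ∧
    y ∈ ({i1 (b1 w0), i2 (b2 w0)} : Set D), ⟨?_, ?_, ?_⟩, ⟨?_, ?_, ?_⟩, ?_, ?_⟩
  rotate_left 6
  · have := PartTD.start (i1 (b1 w0)) (i2 (b2 w0))
    rw [Set.image_singleton, Set.image_singleton]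
    exact this
  · rintro w rfl
    simp
  · rintro w rfl; rfl
  · rintro u rfl; exact Or.inl ⟨w0, rfl, rfl⟩
  · rintro u rfl; exact Reachable.refl _
  · rintro w rfl; rfl
  · rintro u rfl; exact Or.inl ⟨w0, rfl, rfl⟩
  · rintro u rfl; exact Reachable.refl _

lemma PairInv.step {V1 V2 D W : Type*} {N1 H1 : SimpleGraph V1} {N2 H2 : SimpleGraph V2}
    {i1 : V1 → D} {i2 : V2 → D} {b1 : W → V1} {b2 : W → V2} {w0 : W} {Q : Set W}
    (h : PairInv N1 H1 N2 H2 i1 i2 b1 b2 w0 Q)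
    (hi1 : Function.Injective i1) (hi2 : Function.Injective i2)
    (hb1 : Function.Injective b1) (hb2 : Function.Injective b2)
    (hH1 : H1 ≤ N1) (hH2 : H2 ≤ N2)
    (glue : ∀ x y, i1 x = i2 y → ∃ w, b1 w = x ∧ b2 w = y)
    {w w' : W} (hw : w ∈ Q) (hw' : w' ∉ Q)
    (p1 : H1.Walk (b1 w) (b1 w')) (hp1 : GoodPath H1 b1 w w' p1)
    (p2 : H2.Walk (b2 w) (b2 w')) (hp2 : GoodPath H2 b2 w w' p2) :
    PairInv N1 H1 N2 H2 i1 i2 b1 b2 w0 (insert w' Q) := by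
  obtain ⟨U1, U2, R, S1, S2, hP, hR⟩ := h
  have f1 := S1.fresh hb1 hw' p1 hp1
  have f2 := S2.fresh hb2 hw' p2 hp2
  -- first walk; work with a symmetric relation
  let R0 : D → D → Prop := fun x y => R x y ∨ R y x
  have hP0 : PartTD (i1 '' U1 ∪ i2 '' U2) R0 := hP.symm
  obtain ⟨R1, hR1, hP1, hb, hr1⟩ := walk_step hi1 p1 hp1.1 (i2 (b2 w)) _ R0 hP0
    (Or.inr (hR w hw)) (by
      intro x hx hne
      left
      rintro (⟨y, hy, hyx⟩ | ⟨y, hy, hyx⟩)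
      · exact f1 x hx hne (hi1 hyx ▸ hy)
      · obtain ⟨v, rfl, rfl⟩ := glue x y hyx.symm
        exact f1 _ hx hne (S1.branch v (S2.mem_branch hb2 hy)))
  let R1' : D → D → Prop := fun x y => R1 x y ∨ R1 y x
  have hP1' : PartTD _ R1' := hP1.symm
  obtain ⟨R2, hR2, hP2, hbb, hr2⟩ := walk_step hi2 p2 hp2.1 (i1 (b1 w')) _ R1' hP1'
    (Or.inr hb) (by
      intro x hx hne
      have hxU := f2 x hx hne
      by_contra! hcon
      obtain ⟨hc1, hc2⟩ := hcon
      rcases hc1 with (⟨y, hy, hyx⟩ | ⟨y, hy, hyx⟩) | ⟨y, hy, hyx⟩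
      · obtain ⟨v, rfl, rfl⟩ := glue _ _ hyx
        exact hxU (S2.branch v (S1.mem_branch hb1 hy))
      · exact hxU (hi2 hyx ▸ hy)
      · obtain ⟨v, rfl, rfl⟩ := glue _ _ hyx
        rcases hp1.2 _ hy with h | h | h
        · exact hne (by rw [hb1 h])
        · exact hc2 (by rw [← hyx, h])
        · exact h.1 ⟨v, rfl⟩)
  have hle1 : ∀ x y, R1 x y → R2 x y := fun x y h => hR2 _ _ (Or.inl h)
  have hle : ∀ x y, R x y → R2 x y := fun x y h => hle1 _ _ (hR1 _ _ (Or.inl h))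
  refine ⟨_, _, R2, S1.extend hH1 hle hw p1 hp1 (fun x hx =>
    (hr1 x hx).mono (Cov.mono le_rfl hle1)), S2.extend hH2 hle hw p2 hp2 hr2, ?_, ?_⟩
  · have : i1 '' (U1 ∪ {x | x ∈ p1.support}) ∪ i2 '' (U2 ∪ {x | x ∈ p2.support}) =
      i1 '' U1 ∪ i2 '' U2 ∪ i1 '' {x | x ∈ p1.support} ∪ i2 '' {x | x ∈ p2.support} := by
      rw [Set.image_union, Set.image_union]
      ext; simp only [Set.mem_union]; tauto
    rw [this]
    exact hP2
  · rintro v (rfl | hv)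
    · exact hbb
    · exact hle _ _ (hR v hv)

lemma PairInv.all {V1 V2 D W : Type*} [Finite W] {T : SimpleGraph W} (hT : T.Connected)
    {N1 H1 : SimpleGraph V1} {N2 H2 : SimpleGraph V2}
    {i1 : V1 → D} {i2 : V2 → D} {b1 : W → V1} {b2 : W → V2} (w0 : W)
    (hi1 : Function.Injective i1) (hi2 : Function.Injective i2)
    (hb1 : Function.Injective b1) (hb2 : Function.Injective b2)
    (hH1 : H1 ≤ N1) (hH2 : H2 ≤ N2)
    (glue : ∀ x y, i1 x = i2 y → ∃ w, b1 w = x ∧ b2 w = y)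
    (hp1 : ∀ w w', T.Adj w w' → ∃ p, GoodPath H1 b1 w w' p)
    (hp2 : ∀ w w', T.Adj w w' → ∃ p, GoodPath H2 b2 w w' p) :
    PairInv N1 H1 N2 H2 i1 i2 b1 b2 w0 Set.univ := by
  obtain ⟨Q, hQ⟩ := (Set.toFinite {Q : Set W | w0 ∈ Q ∧
    PairInv N1 H1 N2 H2 i1 i2 b1 b2 w0 Q}).exists_maximal
    ⟨{w0}, rfl, PairInv.start N1 H1 N2 H2 i1 i2 b1 b2 w0⟩
  have hQI := hQ.prop
  by_cases hu : Q = Set.univ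
  · rw [← hu]; exact hQI.2
  · exfalso
    obtain ⟨z, hz⟩ := (Set.ne_univ_iff_exists_notMem Q).1 hu
    obtain ⟨p⟩ := hT.preconnected w0 z
    obtain ⟨d, -, hd1, hd2⟩ := p.exists_boundary_dart Q hQI.1 hz
    obtain ⟨q1, hq1⟩ := hp1 _ _ d.adj
    obtain ⟨q2, hq2⟩ := hp2 _ _ d.adj
    have := hQI.2.step hi1 hi2 hb1 hb2 hH1 hH2 glue hd1 hd2 q1 hq1 q2 hq2
    exact hd2 (hQ.le_of_ge (y := insert d.snd Q) ⟨Or.inr hQI.1, this⟩ (Set.subset_insert _ _)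
      (Set.mem_insert _ _))

/-- Adding the remaining vertices on one side as pendants. -/
lemma pendant {V D : Type*} [Finite V] {N : SimpleGraph V} (hN : N.Connected) {i : V → D}
    (hi : Function.Injective i) {U : Set D} {R : D → D → Prop} (hP : PartTD U R) (r : V)
    (hr : i r ∈ U) (hc : ∀ v, i v ∈ U → (Cov N i R).Reachable r v) :
    ∃ R' : D → D → Prop, (∀ x y, R x y → R' x y) ∧ PartTD (U ∪ Set.range i) R' ∧
      (Cov N i R').Connected := by
  obtain ⟨A, hA⟩ := (Set.toFinite {A : Set V | ∃ R' : D → D → Prop, (∀ x y, R x y → R' x y) ∧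
    PartTD (U ∪ i '' A) R' ∧ ∀ v, i v ∈ U ∪ i '' A → (Cov N i R').Reachable r v}).exists_maximal
    ⟨∅, R, fun _ _ h => h, by simpa using hP, by simpa using hc⟩
  obtain ⟨R', h1, h2, h3⟩ := hA.prop
  by_cases hall : ∀ v, i v ∈ U ∪ i '' A
  · refine ⟨R', h1, ?_, ?_⟩
    · have : U ∪ Set.range i = U ∪ i '' A := by
        apply Set.Subset.antisymm
        · rintro x (hx | ⟨v, rfl⟩)
          · exact Or.inl hx
          · exact hall v
        · exact Set.union_subset_union_right _ (Set.image_subset_range _ _)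
      rwa [this]
    · exact { preconnected := fun x y => (h3 x (hall x)).symm.trans (h3 y (hall y)),
              nonempty := ⟨r⟩ }
  · exfalso
    push Not at hall
    obtain ⟨z, hz⟩ := hall
    obtain ⟨p⟩ := hN.preconnected r z
    obtain ⟨d, -, hd1, hd2⟩ := p.exists_boundary_dart (i ⁻¹' (U ∪ i '' A)) (Or.inl hr) hz
    have hs := h2.refl.step (a := i d.fst) (b := i d.fst) (Or.inr ⟨rfl, hd1⟩) hd2
    have hmem : d.snd ∈ A := by
      refine hA.le_of_ge (y := insert d.snd A)
        ⟨fun x y => (R' x y ∨ x = y ∧ x ∈ U ∪ i '' A) ∨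
          (x ∈ ({i d.snd, i d.fst, i d.fst} : Set D) ∧
            y ∈ ({i d.snd, i d.fst, i d.fst} : Set D)), ?_, ?_, ?_⟩ (Set.subset_insert _ _)
        (Set.mem_insert _ _)
      rotate_left
      · rw [Set.image_insert_eq, Set.union_insert]
        exact hs
      · intro v hv
        rw [Set.image_insert_eq, Set.union_insert] at hv
        rcases hv with hv | hv
        · rw [hi hv]
          refine ((h3 _ hd1).mono (Cov.mono le_rfl (fun x y h => Or.inl (Or.inl h)))).trans
            (Adj.reachable ⟨d.adj, Or.inl (Or.inr ⟨by simp, by simp⟩)⟩)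
        · exact (h3 v hv).mono (Cov.mono le_rfl (fun x y h => Or.inl (Or.inl h)))
      · exact fun x y h => Or.inl (Or.inl (h1 x y h))
    exact hd2 (Or.inr ⟨_, hmem, rfl⟩)

lemma uncovered {V D : Type*} [Finite V] (N : SimpleGraph V) (i : V → D) (R : D → D → Prop)
    (hc : (Cov N i R).Connected) :
    ∃ Z : Finset D, Z.card ≤ N.edgeSet.ncard - (Nat.card V - 1) ∧
      ∀ u v, N.Adj u v → R (i u) (i v) ∨ R (i v) (i u) ∨ i u ∈ Z ∨ i v ∈ Z := by
  classical
  have hsub : (Cov N i R).edgeSet ⊆ N.edgeSet := edgeSet_subset_edgeSet.2 (fun _ _ h => h.1)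
  have hcard := hc.card_vert_le_card_edgeSet_add_one
  rw [Nat.card_coe_set_eq] at hcard
  have hE := Set.ncard_sdiff_add_ncard_of_subset hsub
  let E : Finset (Sym2 V) := (Set.toFinite (N.edgeSet \ (Cov N i R).edgeSet)).toFinset
  refine ⟨E.image (fun e => i (Quot.out e).1), ?_, ?_⟩
  · refine Finset.card_image_le.trans ?_
    have : E.card = (N.edgeSet \ (Cov N i R).edgeSet).ncard :=
      (Set.ncard_eq_toFinset_card _ _).symm
    omega
  · intro u v huv
    by_cases hR : R (i u) (i v) ∨ R (i v) (i u)
    · tauto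
    · have hmem : s(u, v) ∈ E := by
        simp only [E, Set.Finite.mem_toFinset]
        exact ⟨huv, fun h => hR h.2⟩
      have h2 : (Quot.out s(u, v)).1 ∈ s(u, v) := Sym2.out_fst_mem _
      have h3 := Finset.mem_image_of_mem (fun e => i (Quot.out e).1) hmem
      rw [Sym2.mem_iff] at h2
      rcases h2 with h2 | h2
      · right; right; left
        simpa only [h2] using h3
      · right; right; right
        simpa only [h2] using h3

lemma final_decomp {V1 V2 D : Type*} [Finite V1] [Finite V2] (N1 : SimpleGraph V1)
    (N2 : SimpleGraph V2) (i1 : V1 → D) (i2 : V2 → D) (G : SimpleGraph D)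
    (R : D → D → Prop) (hP : PartTD Set.univ R)
    (hc1 : (Cov N1 i1 R).Connected) (hc2 : (Cov N2 i2 R).Connected)
    (hG : ∀ a b, G.Adj a b → (∃ u v, N1.Adj u v ∧ a = i1 u ∧ b = i1 v) ∨
      (∃ u v, N2.Adj u v ∧ a = i2 u ∧ b = i2 v)) :
    HasTreeDecompWidthLE G ((N1.edgeSet.ncard - (Nat.card V1 - 1)) +
      (N2.edgeSet.ncard - (Nat.card V2 - 1)) + 2) := by
  classical
  obtain ⟨Z1, hZ1, hZ1'⟩ := uncovered N1 i1 R hc1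
  obtain ⟨Z2, hZ2, hZ2'⟩ := uncovered N2 i2 R hc2
  obtain ⟨n, t, bag, h1, h2, h3, h4, h5⟩ := hP
  have hex : ∀ v, ∃ i, v ∈ bag i := by
    intro v
    obtain ⟨i, hi⟩ := (h3 v trivial).nonempty
    exact ⟨i, hi⟩
  refine ⟨n, t, fun i => bag i ∪ (Z1 ∪ Z2), h1, ?_, ?_, ?_, ?_⟩
  · intro v
    obtain ⟨i, hi⟩ := hex v
    exact ⟨i, Finset.mem_union_left _ hi⟩
  · have key : ∀ a b, R a b ∨ R b a ∨ a ∈ Z1 ∪ Z2 ∨ b ∈ Z1 ∪ Z2 →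
        ∃ i, a ∈ bag i ∪ (Z1 ∪ Z2) ∧ b ∈ bag i ∪ (Z1 ∪ Z2) := by
      rintro a b (h | h | h | h)
      · obtain ⟨i, ha, hb⟩ := h5 _ _ h
        exact ⟨i, Finset.mem_union_left _ ha, Finset.mem_union_left _ hb⟩
      · obtain ⟨i, ha, hb⟩ := h5 _ _ h
        exact ⟨i, Finset.mem_union_left _ hb, Finset.mem_union_left _ ha⟩
      · obtain ⟨i, hi⟩ := hex b
        exact ⟨i, Finset.mem_union_right _ h, Finset.mem_union_left _ hi⟩
      · obtain ⟨i, hi⟩ := hex a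
        exact ⟨i, Finset.mem_union_left _ hi, Finset.mem_union_right _ h⟩
    intro a b hab
    apply key
    rcases hG a b hab with ⟨u, v, huv, rfl, rfl⟩ | ⟨u, v, huv, rfl, rfl⟩
    · have := hZ1' u v huv
      simp only [Finset.mem_union]
      tauto
    · have := hZ2' u v huv
      simp only [Finset.mem_union]
      tauto
  · intro v
    by_cases hv : v ∈ Z1 ∪ Z2
    · have : {i | v ∈ bag i ∪ (Z1 ∪ Z2)} = Set.univ := by
        ext i
        simp only [Set.mem_ofPred_eq, Set.mem_univ, iff_true]
        exact Finset.mem_union_right _ hv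
      rw [this]
      exact (induceUnivIso t).connected_iff.2 h1.connected
    · have : {i | v ∈ bag i ∪ (Z1 ∪ Z2)} = {i | v ∈ bag i} := by
        ext i
        simp only [Set.mem_ofPred_eq, Finset.mem_union (s := bag i), hv, or_false]
      rw [this]
      exact h3 v trivial
  · intro i
    have a1 := Finset.card_union_le (bag i) (Z1 ∪ Z2)
    have a2 := Finset.card_union_le Z1 Z2
    have a3 := h4 i
    show (bag i ∪ (Z1 ∪ Z2)).card ≤ _
    omega

lemma Displays.data {V W X : Type*} {N : PhyloGraph V X} {T : PhyloTree W X}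
    (h : Displays N T) :
    ∃ (H : SimpleGraph V) (b : W → V), H ≤ N.graph ∧ Function.Injective b ∧
      (∀ x, b (T.leaf x) = N.leaf x) ∧
      ∀ w w', T.graph.Adj w w' → ∃ p, GoodPath H b w w' p := by
  classical
  obtain ⟨S, -, e, hl⟩ := h
  have := N.finite
  let f : S.coe →g S.spanningCoe := ⟨Subtype.val, fun h => h⟩
  have hf : Function.Injective f := Subtype.val_injective
  refine ⟨S.spanningCoe, fun w => ((e.symm w).1 : S.verts).1, S.spanningCoe_le, ?_, hl, ?_⟩
  · intro a b hab
    exact e.symm.injective (Subtype.ext (Subtype.ext hab))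
  · intro w w' hww
    have hadj : (Smoothing S.coe).Adj (e.symm w) (e.symm w') := e.symm.map_adj_iff.2 hww
    have hex : ∃ p : S.coe.Walk (e.symm w).1 (e.symm w').1, p.IsPath ∧
        ∀ x ∈ p.support, x = (e.symm w).1 ∨ x = (e.symm w').1 ∨
          (S.coe.neighborSet x).ncard = 2 := by
      rcases (SimpleGraph.fromRel_adj _ _ _).1 hadj with ⟨-, h | ⟨p, hp, hs⟩⟩
      · exact h
      · refine ⟨p.reverse, hp.reverse, fun x hx => ?_⟩
        rw [Walk.support_reverse, List.mem_reverse] at hx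
        have := hs x hx
        tauto
    obtain ⟨p, hp, hs⟩ := hex
    refine ⟨p.map f, hp.map hf, ?_⟩
    intro x hx
    rw [Walk.support_map, List.mem_map] at hx
    obtain ⟨x, hx, rfl⟩ := hx
    by_cases hx1 : x = (e.symm w).1
    · left; rw [hx1]; rfl
    by_cases hx2 : x = (e.symm w').1
    · right; left; rw [hx2]; rfl
    right; right
    have hdeg : (S.coe.neighborSet x).ncard = 2 := by
      have := hs x hx
      tauto
    constructor
    · rintro ⟨v, hv⟩
      have hv' : (e.symm v).1 = x := Subtype.ext hv
      exact (e.symm v).2 (hv' ▸ hdeg)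
    · intro y hy
      have hyS : S.Adj x.1 y := hy
      have hyv : y ∈ S.verts := S.edge_vert hyS.symm
      obtain ⟨k, hk, hkl⟩ := Walk.mem_support_iff_exists_getVert.1 hx
      have hk0 : k ≠ 0 := by
        rintro rfl
        rw [Walk.getVert_zero] at hk
        exact hx1 hk.symm
      have hkl' : k < p.length := by
        refine lt_of_le_of_ne hkl ?_
        rintro rfl
        rw [Walk.getVert_length] at hk
        exact hx2 hk.symm
      have h2 := hp.ncard_neighborSet_toSubgraph_internal_eq_two hk0 hkl'
      rw [hk] at h2
      have heq : p.toSubgraph.neighborSet x = S.coe.neighborSet x :=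
        Set.eq_of_subset_of_ncard_le (p.toSubgraph.neighborSet_subset x) (by rw [h2, hdeg])
          (Set.toFinite _)
      have hym : (⟨y, hyv⟩ : S.verts) ∈ S.coe.neighborSet x := hyS
      rw [← heq] at hym
      have hyp : (⟨y, hyv⟩ : S.verts) ∈ p.support := by
        rw [← Walk.mem_verts_toSubgraph]
        exact p.toSubgraph.edge_vert (p.toSubgraph.adj_symm hym)
      rw [Walk.support_map, List.mem_map]
      exact ⟨_, hyp, rfl⟩

lemma mergeMap_leaf {V1 V2 X : Type*} (l1 : X → V1) (l2 : X → V2)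
    (h2 : Function.Injective l2) (x : X) :
    mergeMap l1 l2 (Sum.inr (l2 x)) = Sum.inl (l1 x) := by
  have h : ∃ y, l2 y = l2 x := ⟨x, rfl⟩
  have : h.choose = x := h2 h.choose_spec
  simp only [mergeMap, dif_pos h, this]

lemma mergeMap_nonleaf {V1 V2 X : Type*} (l1 : X → V1) (l2 : X → V2) (w : V2)
    (h : ¬ ∃ x, l2 x = w) :
    mergeMap l1 l2 (Sum.inr w) = Sum.inr w := by
  simp only [mergeMap, dif_neg h]

/-- If two unrooted binary phylogenetic networks `N1`, `N2` on the same label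
set `X` with `|X| ≥ 3` both display some unrooted binary phylogenetic tree `T`
on `X`, then `tw(D(N1,N2)) ≤ r(N1) + r(N2) + 2`. -/
theorem treewidth_display_networks_le {V1 V2 W X : Type*}
    (N1 : PhyloGraph V1 X) (N2 : PhyloGraph V2 X) (T : PhyloTree W X)
    (hX : 3 ≤ Nat.card X)
    (h1 : Displays N1 T) (h2 : Displays N2 T) :
    treewidth (displayGraph N1.graph N1.leaf N2.graph N2.leaf) ≤
      reticNumber N1 + reticNumber N2 + 2 := by
  have := N1.finite
  have := N2.finite
  have := T.finite
  obtain ⟨H1, b1, hH1, hb1, hl1, hp1⟩ := h1.data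
  obtain ⟨H2, b2, hH2, hb2, hl2, hp2⟩ := h2.data
  obtain ⟨w0⟩ := T.connected.nonempty
  let i1 : V1 → DisplayVertex N1.leaf N2.leaf := fun u => toDisplay N1.leaf N2.leaf (Sum.inl u)
  let i2 : V2 → DisplayVertex N1.leaf N2.leaf := fun u => toDisplay N1.leaf N2.leaf (Sum.inr u)
  have hi1 : Function.Injective i1 := by
    intro a b hab
    have h : (Sum.inl a : V1 ⊕ V2) = Sum.inl b := congrArg Subtype.val hab
    exact Sum.inl_injective h
  have hi2 : Function.Injective i2 := by
    intro a b hab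
    have h : mergeMap N1.leaf N2.leaf (Sum.inr a) = mergeMap N1.leaf N2.leaf (Sum.inr b) :=
      congrArg Subtype.val hab
    by_cases ha : ∃ x, N2.leaf x = a
    · obtain ⟨x, rfl⟩ := ha
      rw [mergeMap_leaf _ _ N2.leaf_inj] at h
      by_cases hb : ∃ x, N2.leaf x = b
      · obtain ⟨y, rfl⟩ := hb
        rw [mergeMap_leaf _ _ N2.leaf_inj] at h
        rw [N1.leaf_inj (Sum.inl_injective h)]
      · rw [mergeMap_nonleaf _ _ _ hb] at h
        cases h
    · rw [mergeMap_nonleaf _ _ _ ha] at h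
      by_cases hb : ∃ x, N2.leaf x = b
      · obtain ⟨y, rfl⟩ := hb
        rw [mergeMap_leaf _ _ N2.leaf_inj] at h
        cases h
      · rw [mergeMap_nonleaf _ _ _ hb] at h
        exact Sum.inr_injective h
  have glue : ∀ x y, i1 x = i2 y → ∃ w, b1 w = x ∧ b2 w = y := by
    intro x y hxy
    have h : (Sum.inl x : V1 ⊕ V2) = mergeMap N1.leaf N2.leaf (Sum.inr y) :=
      congrArg Subtype.val hxy
    by_cases hy : ∃ z, N2.leaf z = y
    · obtain ⟨z, rfl⟩ := hy
      rw [mergeMap_leaf _ _ N2.leaf_inj] at h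
      exact ⟨T.leaf z, by rw [hl1, Sum.inl_injective h], hl2 z⟩
    · rw [mergeMap_nonleaf _ _ _ hy] at h
      cases h
  have hsurj : ∀ d, d ∈ Set.range i1 ∪ Set.range i2 := by
    rintro ⟨u | u, hu⟩
    · exact Or.inl ⟨u, Subtype.ext rfl⟩
    · exact Or.inr ⟨u, Subtype.ext hu⟩
  obtain ⟨U1, U2, R, S1, S2, hP, hR⟩ := PairInv.all (N1 := N1.graph) (N2 := N2.graph)
    T.connected w0 hi1 hi2 hb1 hb2 hH1 hH2 glue hp1 hp2
  obtain ⟨R1, hR1, hP1, hc1⟩ := pendant N1.connected hi1 hP (b1 w0)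
    (Or.inl ⟨_, S1.branch w0 trivial, rfl⟩) (by
      rintro v (⟨y, hy, hyv⟩ | ⟨y, hy, hyv⟩)
      · exact S1.conn v (hi1 hyv ▸ hy)
      · obtain ⟨w, rfl, rfl⟩ := glue _ _ hyv.symm
        exact S1.conn _ (S1.branch w trivial))
  obtain ⟨R2, hR2, hP2, hc2⟩ := pendant N2.connected hi2 hP1 (b2 w0)
    (Or.inl (Or.inr ⟨_, S2.branch w0 trivial, rfl⟩)) (by
      have hm : ∀ v ∈ U2, (Cov N2.graph i2 R1).Reachable (b2 w0) v :=
        fun v hv => (S2.conn v hv).mono (Cov.mono le_rfl hR1)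
      rintro v ((⟨y, hy, hyv⟩ | ⟨y, hy, hyv⟩) | ⟨y, hyv⟩)
      · obtain ⟨w, rfl, rfl⟩ := glue _ _ hyv
        exact hm _ (S2.branch w trivial)
      · exact hm v (hi2 hyv ▸ hy)
      · obtain ⟨w, rfl, rfl⟩ := glue _ _ hyv
        exact hm _ (S2.branch w trivial))
  have huniv : i1 '' U1 ∪ i2 '' U2 ∪ Set.range i1 ∪ Set.range i2 = Set.univ := by
    apply Set.eq_univ_of_forall
    intro d
    rcases hsurj d with h | h
    · exact Or.inl (Or.inr h)
    · exact Or.inr h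
  rw [huniv] at hP2
  refine Nat.sInf_le ?_
  refine final_decomp N1.graph N2.graph i1 i2 _ R2 hP2 (hc1.mono (Cov.mono le_rfl hR2)) hc2 ?_
  intro a b hab
  rcases (SimpleGraph.fromRel_adj _ _ _).1 hab with ⟨-, h | h⟩
  · exact h
  · rcases h with ⟨u, v, huv, ha, hb⟩ | ⟨u, v, huv, ha, hb⟩
    · exact Or.inl ⟨v, u, huv.symm, hb, ha⟩
    · exact Or.inr ⟨v, u, huv.symm, hb, ha⟩
end
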